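/- Let F₁, F₂ be finite-dimensional C*-algebras and φ₀, φ₁ : F₁ → F₂ *-homomorphisms, and let B = A(F₁, F₂, φ₀, φ₁) be the associated Elliott–Thomsen building block. Let e ∈ B be a positive element with ‖e‖ = 1 such that the hereditary C*-subalgebra A = closure(eBe) is full in B. Then for every unitary u ∈ CU(Ã) and every ε > 0 there exists a continuous path of unitaries {u(t) : t ∈ [0,1]} contained in CU(Ã) with u(0) = u, u(1) = 1, whose length is at most 4π + ε. -/

import Mathlib

open unitInterval
open scoped ENNReal

noncomputable section

/-- The Elliott–Thomsen building block `A(F₁, F₂, φ₀, φ₁)`, realized as the subset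
`{(f, g) ∈ C([0,1], F₂) ⊕ F₁ : f 0 = φ₀ g ∧ f 1 = φ₁ g}` of `C([0,1], F₂) × F₁`. -/
def ETBlock {F₁ F₂ : Type*} [CStarAlgebra F₁] [CStarAlgebra F₂]
    (φ₀ φ₁ : F₁ →⋆ₙₐ[ℂ] F₂) : Set (C(I, F₂) × F₁) :=
  {p | p.1 0 = φ₀ p.2 ∧ p.1 1 = φ₁ p.2}

/-- The hereditary C⋆-subalgebra `closure (e B e)` generated by `e` relative to `B`. -/
def herSet {E : Type*} [NonUnitalCStarAlgebra E] (B : Set E) (e : E) : Set E :=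
  closure {x | ∃ b ∈ B, x = e * b * e}

/-- `S` is full in `B` if it is not contained in any proper closed two-sided ideal of `B`:
every closed two-sided ideal of `B` containing `S` is all of `B`. -/
def IsFullIn {E : Type*} [NonUnitalCStarAlgebra E] (S B : Set E) : Prop :=
  ∀ J : Set E, J ⊆ B → (0 : E) ∈ J → (∀ x ∈ J, ∀ y ∈ J, x + y ∈ J) →
    (∀ c : ℂ, ∀ x ∈ J, c • x ∈ J) → (∀ b ∈ B, ∀ x ∈ J, b * x ∈ J ∧ x * b ∈ J) →
    IsClosed J → S ⊆ J → J = B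

/-- The unitary group `U(Ã)` of the unitization `Ã` of the C⋆-subalgebra `A ⊆ E`, realized
inside `Unitization ℂ E`: `Ã` corresponds to `{z | z.snd ∈ A}`. -/
def unitizationUnitary {E : Type*} [NonUnitalCStarAlgebra E] (A : Set E) :
    Set (Unitization ℂ E) :=
  {v | v ∈ unitary (Unitization ℂ E) ∧ v.snd ∈ A}

/-- `CU(Ã)`: the closure of the commutator subgroup of the unitary group of the unitization of
the C⋆-subalgebra `A ⊆ E`, realized inside `Unitization ℂ E` as the set of limits of finite
products of multiplicative commutators `a b a⁻¹ b⁻¹ = a b (star a) (star b)` of unitaries. -/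
def unitizationCU {E : Type*} [NonUnitalCStarAlgebra E] (A : Set E) :
    Set (Unitization ℂ E) :=
  closure {z | ∃ l : List (Unitization ℂ E),
    (∀ v ∈ l, ∃ a ∈ unitizationUnitary A, ∃ b ∈ unitizationUnitary A,
      v = a * b * star a * star b) ∧ z = l.prod}

namespace CUPath

open NormedSpace Filter Topology

section Uexp

variable {𝔸 : Type*} [NormedRing 𝔸] [NormedAlgebra ℂ 𝔸]

/-- The exponential `a ↦ exp (i a)`. -/
def uexp (a : 𝔸) : 𝔸 := exp (Complex.I • a)

lemma uexp_zero : uexp (0 : 𝔸) = 1 := by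
  simp [uexp]

lemma commute_uexp_right {a b : 𝔸} (h : Commute a b) : Commute a (uexp b) := by
  let _ : NormedAlgebra ℚ 𝔸 := .restrictScalars ℚ ℂ 𝔸
  exact (h.smul_right _).exp_right

variable [CompleteSpace 𝔸]

lemma continuous_uexp : Continuous (uexp : 𝔸 → 𝔸) := by
  let _ : NormedAlgebra ℚ 𝔸 := .restrictScalars ℚ ℂ 𝔸
  exact exp_continuous.comp (continuous_const_smul _)

lemma uexp_add_of_commute {a b : 𝔸} (h : Commute a b) : uexp (a + b) = uexp a * uexp b := by
  let _ : NormedAlgebra ℚ 𝔸 := .restrictScalars ℚ ℂ 𝔸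
  rw [uexp, smul_add, exp_add_of_commute]
  · rfl
  · exact (h.smul_left _).smul_right _

lemma uexp_mul_uexp_neg (a : 𝔸) : uexp a * uexp (-a) = 1 := by
  rw [← uexp_add_of_commute (Commute.refl a).neg_right]
  simp [uexp_zero]

lemma uexp_neg_mul_uexp (a : 𝔸) : uexp (-a) * uexp a = 1 := by
  simpa using uexp_mul_uexp_neg (-a)

lemma uexp_nsmul (n : ℕ) (a : 𝔸) : uexp (n • a) = uexp a ^ n := by
  let _ : NormedAlgebra ℚ 𝔸 := .restrictScalars ℚ ℂ 𝔸
  rw [uexp, smul_comm, exp_nsmul]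
  rfl

lemma map_uexp {𝔹 : Type*} [NormedRing 𝔹] [NormedAlgebra ℂ 𝔹]
    {F : Type*} [FunLike F 𝔸 𝔹] [AlgHomClass F ℂ 𝔸 𝔹] (f : F) (hf : Continuous f) (a : 𝔸) :
    f (uexp a) = uexp (f a) := by
  let _ : NormedAlgebra ℚ 𝔸 := .restrictScalars ℚ ℂ 𝔸
  let _ : NormedAlgebra ℚ 𝔹 := .restrictScalars ℚ ℂ 𝔹
  rw [uexp, map_exp f hf, map_smul, uexp]

lemma uexp_conj {v w : 𝔸} (hvw : v * w = 1) (hwv : w * v = 1) (a : 𝔸) :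
    uexp (v * a * w) = v * uexp a * w := by
  let _ : NormedAlgebra ℚ 𝔸 := .restrictScalars ℚ ℂ 𝔸
  have := exp_units_conj (⟨v, w, hvw, hwv⟩ : 𝔸ˣ) (Complex.I • a)
  simpa [uexp] using this

lemma hasDerivAt_uexp_smul (a : 𝔸) (t : ℝ) :
    HasDerivAt (fun s : ℝ => uexp (s • a)) (uexp (t • a) * (Complex.I • a)) t := by
  have := hasDerivAt_exp_smul_const (𝕂 := ℝ) (Complex.I • a) t
  simp only [smul_comm _ Complex.I] at this ⊢
  exact this

end Uexp

section CStar

variable {𝔸 : Type*} [CStarAlgebra 𝔸]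

lemma star_uexp {a : 𝔸} (ha : IsSelfAdjoint a) : star (uexp a) = uexp (-a) := by
  rw [uexp, star_exp, star_smul, ha.star_eq]
  simp [uexp]

lemma uexp_mem_unitary {a : 𝔸} (ha : IsSelfAdjoint a) : uexp a ∈ unitary 𝔸 := by
  rw [Unitary.mem_iff, star_uexp ha]
  exact ⟨uexp_neg_mul_uexp a, uexp_mul_uexp_neg a⟩

lemma norm_le_one_of_mem_unitary {v : 𝔸} (hv : v ∈ unitary 𝔸) : ‖v‖ ≤ 1 := by
  rcases subsingleton_or_nontrivial 𝔸 with h | h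
  · simp [Subsingleton.elim v 0]
  · exact (CStarRing.norm_of_mem_unitary hv).le

lemma isSelfAdjoint_real_smul {a : 𝔸} (ha : IsSelfAdjoint a) (s : ℝ) : IsSelfAdjoint (s • a) := by
  rw [IsSelfAdjoint, star_smul, ha.star_eq, star_trivial]

lemma norm_uexp_smul_sub_le {a : 𝔸} (ha : IsSelfAdjoint a) (s t : ℝ) :
    ‖uexp (s • a) - uexp (t • a)‖ ≤ ‖a‖ * |s - t| := by
  have := Convex.norm_image_sub_le_of_norm_hasDerivWithin_le (f := fun s : ℝ => uexp (s • a))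
    (f' := fun t => uexp (t • a) * (Complex.I • a)) (C := ‖a‖) (s := Set.univ) (x := t) (y := s)
    (fun x _ => (hasDerivAt_uexp_smul a x).hasDerivWithinAt) (fun x _ => ?_) convex_univ
    (Set.mem_univ _) (Set.mem_univ _)
  · simpa using this
  · refine (norm_mul_le _ _).trans ?_
    have := norm_le_one_of_mem_unitary (uexp_mem_unitary (isSelfAdjoint_real_smul ha x))
    rw [norm_smul, Complex.norm_I, one_mul]
    exact mul_le_of_le_one_left (norm_nonneg _) this

lemma norm_pow_sub_pow_le {v w : 𝔸} (hv : ‖v‖ ≤ 1) (hw : ‖w‖ ≤ 1) (n : ℕ) :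
    ‖v ^ n - w ^ n‖ ≤ n * ‖v - w‖ := by
  rcases subsingleton_or_nontrivial 𝔸 with h | h
  · simp [Subsingleton.elim v w]
  have hp : ∀ n : ℕ, ‖w ^ n‖ ≤ 1 := fun n => (norm_pow_le w n).trans (pow_le_one₀ (norm_nonneg _) hw)
  induction n with
  | zero => simp
  | succ n ih =>
    have : v ^ (n + 1) - w ^ (n + 1) = v * (v ^ n - w ^ n) + (v - w) * w ^ n := by
      rw [pow_succ', pow_succ']; noncomm_ring
    rw [this]
    refine (norm_add_le _ _).trans ?_
    have h1 : ‖v * (v ^ n - w ^ n)‖ ≤ n * ‖v - w‖ :=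
      ((norm_mul_le _ _).trans (mul_le_of_le_one_left (norm_nonneg _) hv)).trans ih
    have h2 : ‖(v - w) * w ^ n‖ ≤ ‖v - w‖ :=
      (norm_mul_le _ _).trans (mul_le_of_le_one_right (norm_nonneg _) (hp n))
    push_cast
    linarith

/-- The Lie product formula for self-adjoint generators. -/
lemma tendsto_uexp_mul_pow {a b : 𝔸} (ha : IsSelfAdjoint a) (hb : IsSelfAdjoint b) :
    Tendsto (fun n : ℕ => (uexp (((n : ℝ) + 1)⁻¹ • a) * uexp (((n : ℝ) + 1)⁻¹ • b)) ^ (n + 1)) atTop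
      (𝓝 (uexp (a + b))) := by
  set f : ℝ → 𝔸 := fun s => uexp (s • a) * uexp (s • b) - uexp (s • (a + b)) with hf
  have hd : HasDerivAt f 0 0 := by
    have := ((hasDerivAt_uexp_smul a 0).mul (hasDerivAt_uexp_smul b 0)).sub
      (hasDerivAt_uexp_smul (a + b) 0)
    have h2 : uexp ((0 : ℝ) • a) * (Complex.I • a) * uexp ((0 : ℝ) • b) +
        uexp ((0 : ℝ) • a) * (uexp ((0 : ℝ) • b) * (Complex.I • b)) -
        uexp ((0 : ℝ) • (a + b)) * (Complex.I • (a + b)) = 0 := by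
      simp [uexp_zero]
    rwa [h2] at this
  have h0 : f 0 = 0 := by simp [hf, uexp_zero]
  have hlim : Tendsto (fun n : ℕ => ((n : ℝ) + 1)⁻¹) atTop (𝓝[≠] 0) := by
    refine tendsto_nhdsWithin_iff.2 ⟨?_, Eventually.of_forall fun n => ?_⟩
    · simpa using tendsto_one_div_add_atTop_nhds_zero_nat (𝕜 := ℝ)
    · have : (0 : ℝ) < (n : ℝ) + 1 := by positivity
      simp [this.ne']
  have hs := ((hasDerivAt_iff_tendsto_slope.1 hd).comp hlim).norm
  rw [tendsto_iff_norm_sub_tendsto_zero]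
  rw [norm_zero] at hs
  refine squeeze_zero (fun _ => norm_nonneg _) (fun n => ?_) hs
  have hpos : (0 : ℝ) < (n : ℝ) + 1 := by positivity
  have hab : uexp (a + b) = uexp (((n : ℝ) + 1)⁻¹ • (a + b)) ^ (n + 1) := by
    rw [← uexp_nsmul, ← Nat.cast_smul_eq_nsmul ℝ, smul_smul]
    push_cast
    rw [mul_inv_cancel₀ hpos.ne', one_smul]
  rw [hab]
  refine (norm_pow_sub_pow_le ?_ ?_ (n + 1)).trans ?_
  · exact norm_le_one_of_mem_unitary (mul_mem (uexp_mem_unitary (isSelfAdjoint_real_smul ha _))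
      (uexp_mem_unitary (isSelfAdjoint_real_smul hb _)))
  · exact norm_le_one_of_mem_unitary (uexp_mem_unitary (isSelfAdjoint_real_smul (ha.add hb) _))
  · rw [Function.comp, slope_def_module, h0, sub_zero, sub_zero, inv_inv, norm_smul,
      Real.norm_of_nonneg hpos.le]
    push_cast
    rfl

/-- If all the products `exp (i s a) exp (i s b)` lie in a closed submonoid, then so do all the
`exp (i s (a + b))`. -/
lemma uexp_add_mem {N : Submonoid 𝔸} (hN : IsClosed (N : Set 𝔸)) {a b : 𝔸}
    (ha : IsSelfAdjoint a) (hb : IsSelfAdjoint b)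
    (h : ∀ s : ℝ, uexp (s • a) * uexp (s • b) ∈ N) (s : ℝ) : uexp (s • (a + b)) ∈ N := by
  rw [smul_add]
  refine hN.mem_of_tendsto (tendsto_uexp_mul_pow (isSelfAdjoint_real_smul ha s)
    (isSelfAdjoint_real_smul hb s)) (Eventually.of_forall fun n => ?_)
  refine pow_mem ?_ _
  simpa [smul_smul] using h (((n : ℝ) + 1)⁻¹ * s)

/-- The self-adjoint elements whose one-parameter unitary group stays in a closed submonoid form
a closed real subspace. -/
def expSubspace (N : Submonoid 𝔸) (hN : IsClosed (N : Set 𝔸)) : Submodule ℝ 𝔸 where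
  carrier := {a | IsSelfAdjoint a ∧ ∀ s : ℝ, uexp (s • a) ∈ N}
  zero_mem' := ⟨.zero _, fun s => by simp [uexp_zero]⟩
  add_mem' := fun ha hb => ⟨ha.1.add hb.1,
    uexp_add_mem hN ha.1 hb.1 fun s => mul_mem (ha.2 s) (hb.2 s)⟩
  smul_mem' := fun c a ha => ⟨isSelfAdjoint_real_smul ha.1 c, fun s => by
    simpa [smul_smul] using ha.2 (s * c)⟩

lemma isClosed_expSubspace (N : Submonoid 𝔸) (hN : IsClosed (N : Set 𝔸)) :
    IsClosed (expSubspace N hN : Set 𝔸) := by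
  have : (expSubspace N hN : Set 𝔸) =
      {a | IsSelfAdjoint a} ∩ ⋂ s : ℝ, (fun a => uexp (s • a)) ⁻¹' (N : Set 𝔸) := by
    ext a
    simp [expSubspace]
  rw [this]
  exact (isClosed_eq continuous_star continuous_id).inter
    (isClosed_iInter fun s => hN.preimage (continuous_uexp.comp (continuous_const_smul s)))

/-- The derivative at `0` of `r ↦ exp (i r a) b exp (-i r a)`. -/
lemma hasDerivAt_conj_uexp (a b : 𝔸) :
    HasDerivAt (fun r : ℝ => uexp (r • a) * b * uexp (r • (-a)))
      (Complex.I • (a * b - b * a)) 0 := by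
  have := ((hasDerivAt_uexp_smul a 0).mul_const b).mul (hasDerivAt_uexp_smul (-a) 0)
  have h2 : uexp ((0 : ℝ) • a) * (Complex.I • a) * b * uexp ((0 : ℝ) • (-a)) +
      uexp ((0 : ℝ) • a) * b * (uexp ((0 : ℝ) • (-a)) * (Complex.I • (-a))) =
      Complex.I • (a * b - b * a) := by
    simp [uexp_zero, sub_eq_add_neg]
  rwa [h2] at this

/-- If a closed submonoid contains all the commutators `v exp (i s b) v⁻¹ exp (-i s b)` with `v`
in the one-parameter group of `a`, then `i [a, b]` exponentiates into it. -/
lemma I_smul_commutator_mem_expSubspace {N : Submonoid 𝔸} (hN : IsClosed (N : Set 𝔸)) {a b : 𝔸}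
    (ha : IsSelfAdjoint a) (hb : IsSelfAdjoint b)
    (h : ∀ r s : ℝ, uexp (r • a) * uexp (s • b) * star (uexp (r • a)) * star (uexp (s • b)) ∈ N) :
    Complex.I • (a * b - b * a) ∈ expSubspace N hN := by
  have key : ∀ r : ℝ, uexp (r • a) * b * uexp (r • (-a)) - b ∈ expSubspace N hN := by
    intro r
    have hra := isSelfAdjoint_real_smul ha r
    have hv : star (uexp (r • a)) = uexp (r • (-a)) := by rw [star_uexp hra, smul_neg]
    have hsa : IsSelfAdjoint (uexp (r • a) * b * uexp (r • (-a))) := by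
      rw [← hv]; exact hb.conjugate _
    have := uexp_add_mem hN hsa hb.neg (a := uexp (r • a) * b * uexp (r • (-a))) (b := -b)
      fun s => ?_
    · rw [← sub_eq_add_neg] at this
      exact ⟨hsa.sub hb, this⟩
    · have h1 : s • (uexp (r • a) * b * uexp (r • (-a))) =
          uexp (r • a) * (s • b) * uexp (r • (-a)) := by simp
      rw [h1, uexp_conj (by rw [smul_neg]; exact uexp_mul_uexp_neg _)
        (by rw [smul_neg]; exact uexp_neg_mul_uexp _), smul_neg s b,
        ← star_uexp (isSelfAdjoint_real_smul hb s), ← hv]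
      exact h r s
  have hd := hasDerivAt_iff_tendsto_slope.1 (hasDerivAt_conj_uexp a b)
  refine (isClosed_expSubspace N hN).mem_of_tendsto hd (Eventually.of_forall fun r => ?_)
  rw [slope_def_module]
  refine Submodule.smul_mem _ _ ?_
  simpa [uexp_zero] using key r

end CStar

end CUPath

namespace CUPath

section Structure

open Matrix
open scoped ComplexOrder MatrixOrder

variable {F : Type*} [CStarAlgebra F] {n : ℕ} {d : Fin n → ℕ}

lemma eq_zero_of_isNilpotent {x : F} (hx : IsSelfAdjoint x) (h : IsNilpotent x) :
    x = 0 := by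
  obtain ⟨m, hm⟩ := h
  have h1 : x ^ (2 ^ m) = 0 := pow_eq_zero_of_le (Nat.lt_two_pow_self).le hm
  have h2 := hx.nnnorm_pow_two_pow m
  rw [h1, nnnorm_zero] at h2
  exact nnnorm_eq_zero.1 (pow_eq_zero_iff (by positivity) |>.1 h2.symm)

lemma isSemisimpleRing_of_finiteDimensional [FiniteDimensional ℂ F] :
    IsSemisimpleRing F := by
  have : IsArtinianRing F := IsArtinianRing.of_finite ℂ F
  rw [IsArtinianRing.isSemisimpleRing_iff_jacobson, eq_bot_iff]
  intro x hx
  have hn : IsNilpotent (Ring.jacobson F) := IsSemiprimaryRing.isNilpotent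
  obtain ⟨m, hm⟩ := hn
  have h1 : star x * x ∈ Ring.jacobson F := Ideal.mul_mem_left _ _ hx
  have h2 : (star x * x) ^ m ∈ Ring.jacobson F ^ m := Ideal.pow_mem_pow h1 m
  rw [hm] at h2
  have h3 : star x * x = 0 := eq_zero_of_isNilpotent (IsSelfAdjoint.star_mul_self x) ⟨m, h2⟩
  exact CStarRing.star_mul_self_eq_zero_iff x |>.1 h3

/-- The sum of the traces of the blocks. -/
def blockTrace (Ψ : F ≃ₐ[ℂ] (i : Fin n) → Matrix (Fin (d i)) (Fin (d i)) ℂ) :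
    F →ₗ[ℂ] ℂ where
  toFun x := ∑ i, (Ψ x i).trace
  map_add' x y := by simp [Finset.sum_add_distrib]
  map_smul' c x := by simp [Finset.mul_sum]

variable (Ψ : F ≃ₐ[ℂ] (i : Fin n) → Matrix (Fin (d i)) (Fin (d i)) ℂ)

lemma mem_spectrum_of_mem_roots {x : F} {i : Fin n} {z : ℂ}
    (hz : z ∈ (Ψ x i).charpoly.roots) : z ∈ spectrum ℂ x := by
  have h1 : z ∈ spectrum ℂ (Ψ x i) :=
    Matrix.mem_spectrum_of_isRoot_charpoly (Polynomial.isRoot_of_mem_roots hz)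
  rw [← AlgEquiv.spectrum_eq Ψ x, Pi.spectrum_eq]
  exact Set.mem_iUnion.2 ⟨i, h1⟩

lemma trace_block_im {x : F} (hx : IsSelfAdjoint x) (i : Fin n) :
    (Ψ x i).trace.im = 0 := by
  rw [Matrix.trace_eq_sum_roots_charpoly, ← Complex.coe_imAddGroupHom, map_multiset_sum]
  refine Multiset.sum_eq_zero fun y hy => ?_
  obtain ⟨z, hz, rfl⟩ := Multiset.mem_map.1 hy
  exact hx.im_eq_zero_of_mem_spectrum (mem_spectrum_of_mem_roots Ψ hz)

lemma nonneg_re_of_mem_spectrum {x : F} {z : ℂ} (hz : z ∈ spectrum ℂ (star x * x)) :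
    0 ≤ z.re := by
  refine spectrum_star_mul_self_nonneg (b := x) z.re ?_
  have h := (IsSelfAdjoint.star_mul_self x).mem_spectrum_eq_re hz
  rw [h] at hz
  simpa using spectrum.of_algebraMap_mem ℂ hz

lemma blockTrace_im {x : F} (hx : IsSelfAdjoint x) : (blockTrace Ψ x).im = 0 := by
  simp [blockTrace, Complex.im_sum, trace_block_im Ψ hx]

lemma blockTrace_star (x : F) : blockTrace Ψ (star x) = star (blockTrace Ψ x) := by
  have h1 := blockTrace_im Ψ (realPart x).2
  have h2 := blockTrace_im Ψ (imaginaryPart x).2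
  conv_lhs => rw [← realPart_add_I_smul_imaginaryPart x]
  conv_rhs => rw [← realPart_add_I_smul_imaginaryPart x]
  simp only [star_add, star_smul, map_add, map_smul, (realPart x).2.star_eq,
    (imaginaryPart x).2.star_eq, smul_eq_mul]
  apply Complex.ext <;> simp [h1, h2]

lemma trace_block_re_nonneg (x : F) (i : Fin n) : 0 ≤ (Ψ (star x * x) i).trace.re := by
  rw [Matrix.trace_eq_sum_roots_charpoly, ← Complex.coe_reAddGroupHom, map_multiset_sum]
  refine Multiset.sum_nonneg fun y hy => ?_
  obtain ⟨z, hz, rfl⟩ := Multiset.mem_map.1 hy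
  exact nonneg_re_of_mem_spectrum (mem_spectrum_of_mem_roots Ψ hz)

lemma blockTrace_re_nonneg (x : F) : 0 ≤ (blockTrace Ψ (star x * x)).re := by
  simp only [blockTrace, LinearMap.coe_mk, AddHom.coe_mk, Complex.re_sum]
  exact Finset.sum_nonneg fun i _ => trace_block_re_nonneg Ψ x i

lemma eq_zero_of_blockTrace_eq_zero {x : F} (h : (blockTrace Ψ (star x * x)).re = 0) :
    x = 0 := by
  have hsa := IsSelfAdjoint.star_mul_self x
  have h0 : ∀ z ∈ spectrum ℂ (star x * x), z = 0 := by
    intro z hz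
    have hz' := hz
    rw [← AlgEquiv.spectrum_eq Ψ, Pi.spectrum_eq] at hz'
    obtain ⟨i, hi⟩ := Set.mem_iUnion.1 hz'
    simp only [blockTrace, LinearMap.coe_mk, AddHom.coe_mk, Complex.re_sum] at h
    have h1 := (Finset.sum_eq_zero_iff_of_nonneg
      fun i _ => trace_block_re_nonneg Ψ x i).1 h i (Finset.mem_univ i)
    rw [Matrix.trace_eq_sum_roots_charpoly, ← Complex.coe_reAddGroupHom, map_multiset_sum] at h1
    rw [hsa.mem_spectrum_eq_re hz]
    have hzr : z ∈ (Ψ (star x * x) i).charpoly.roots :=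
      (Polynomial.mem_roots (Matrix.charpoly_monic _).ne_zero).2
        (Matrix.mem_spectrum_iff_isRoot_charpoly.1 hi)
    have hle : z.re ≤ 0 := by
      rw [← h1]
      refine Multiset.single_le_sum (fun y hy => ?_) _ (Multiset.mem_map_of_mem _ hzr)
      obtain ⟨w, hw, rfl⟩ := Multiset.mem_map.1 hy
      exact nonneg_re_of_mem_spectrum (mem_spectrum_of_mem_roots Ψ hw)
    rw [le_antisymm hle (nonneg_re_of_mem_spectrum hz), Complex.ofReal_zero]
  have h2 : spectralRadius ℂ (star x * x) = 0 := by
    rw [spectralRadius]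
    simp only [ENNReal.iSup_eq_zero]
    intro z hz
    simp [h0 z hz]
  rw [hsa.spectralRadius_eq_nnnorm] at h2
  exact CStarRing.star_mul_self_eq_zero_iff x |>.1 (by simpa using h2)

/-- The element whose `i`-th block has `v` as column `0` and all other entries zero. -/
def column [∀ i, NeZero (d i)] (i : Fin n) (v : Fin (d i) → ℂ) : F :=
  Ψ.symm (Pi.single i (Matrix.of fun k l => if l = 0 then v k else 0))

variable [∀ i, NeZero (d i)]

lemma column_add (i : Fin n) (v w : Fin (d i) → ℂ) :
    column Ψ i (v + w) = column Ψ i v + column Ψ i w := by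
  rw [column, column, column, ← map_add, ← Pi.single_add]
  congr 2
  ext k l
  simp only [of_apply, Pi.add_apply, Matrix.add_apply]
  split_ifs <;> simp

lemma column_smul (i : Fin n) (c : ℂ) (v : Fin (d i) → ℂ) :
    column Ψ i (c • v) = c • column Ψ i v := by
  rw [column, column, ← map_smul, ← Pi.single_smul]
  congr 2
  ext k l
  simp

lemma mul_column (a : F) (i : Fin n) (v : Fin (d i) → ℂ) :
    a * column Ψ i v = column Ψ i (Ψ a i *ᵥ v) := by
  apply Ψ.injective
  simp only [column, map_mul, AlgEquiv.apply_symm_apply]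
  ext j k l
  by_cases hj : j = i
  · subst hj
    by_cases hl : l = 0 <;> simp [Matrix.mul_apply, Matrix.mulVec, dotProduct, hl]
  · simp [hj]

lemma column_eq_zero {i : Fin n} {v : Fin (d i) → ℂ} (h : column Ψ i v = 0) : v = 0 := by
  rw [column, map_eq_zero_iff _ Ψ.symm.injective] at h
  have := congr_fun h i
  simp only [Pi.single_eq_same, Pi.zero_apply] at this
  ext k
  simpa using congr_fun (congr_fun this k) 0

/-- `column` as a linear map. -/
def columnₗ (i : Fin n) : (Fin (d i) → ℂ) →ₗ[ℂ] F where
  toFun := column Ψ i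
  map_add' := column_add Ψ i
  map_smul' := column_smul Ψ i

/-- The Gram matrix of the basis columns of the `i`-th block. -/
def gram (i : Fin n) : Matrix (Fin (d i)) (Fin (d i)) ℂ :=
  Matrix.of fun k l => blockTrace Ψ
    (star (column Ψ i (Pi.single k 1)) * column Ψ i (Pi.single l 1))

lemma dotProduct_gram (i : Fin n) (v w : Fin (d i) → ℂ) :
    star v ⬝ᵥ (gram Ψ i *ᵥ w) = blockTrace Ψ (star (column Ψ i v) * column Ψ i w) := by
  have hv : ∀ v, column Ψ i v = ∑ k, v k • column Ψ i (Pi.single k 1) := by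
    intro v
    change columnₗ Ψ i v = ∑ k, v k • columnₗ Ψ i (Pi.single k 1)
    conv_lhs => rw [pi_eq_sum_univ' v, map_sum]
    refine Finset.sum_congr rfl fun k _ => ?_
    rw [map_smul]
  rw [hv v, hv w]
  simp only [star_sum, star_smul, Finset.sum_mul, Finset.mul_sum, map_sum, smul_mul_assoc,
    mul_smul_comm, map_smul, dotProduct, mulVec, gram, of_apply, smul_eq_mul, Pi.star_apply]
  rw [Finset.sum_comm]
  refine Finset.sum_congr rfl fun k _ => Finset.sum_congr rfl fun l _ => ?_
  ring

lemma posDef_gram (i : Fin n) : (gram Ψ i).PosDef := by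
  refine Matrix.PosDef.of_dotProduct_mulVec_pos ?_ fun x hx => ?_
  · ext k l
    simp [gram, ← blockTrace_star]
  · rw [dotProduct_gram]
    have h1 := blockTrace_re_nonneg Ψ (column Ψ i x)
    have h2 := blockTrace_im Ψ (IsSelfAdjoint.star_mul_self (column Ψ i x))
    have h3 : (blockTrace Ψ (star (column Ψ i x) * column Ψ i x)).re ≠ 0 := fun h =>
      hx (column_eq_zero Ψ (eq_zero_of_blockTrace_eq_zero Ψ h))
    rw [Complex.pos_iff]
    exact ⟨lt_of_le_of_ne h1 h3.symm, h2.symm⟩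

lemma gram_mul (a : F) (i : Fin n) :
    gram Ψ i * Ψ a i = (Ψ (star a) i)ᴴ * gram Ψ i := by
  have key : ∀ M : Matrix (Fin (d i)) (Fin (d i)) ℂ, ∀ k l,
      M k l = star (Pi.single k (1 : ℂ)) ⬝ᵥ (M *ᵥ Pi.single l 1) := by
    intro M k l
    simp
  ext k l
  refine (key (gram Ψ i * Ψ a i) k l).trans (Eq.trans ?_ (key _ k l).symm)
  rw [← Matrix.mulVec_mulVec, ← Matrix.mulVec_mulVec,
    dotProduct_gram, Matrix.dotProduct_mulVec, ← Matrix.star_mulVec, dotProduct_gram,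
    ← mul_column, ← mul_column, star_mul, star_star, mul_assoc]

lemma exists_sqrt_gram (i : Fin n) :
    ∃ S T : Matrix (Fin (d i)) (Fin (d i)) ℂ, S * T = 1 ∧ T * S = 1 ∧ gram Ψ i = Sᴴ * S := by
  have hP := posDef_gram Ψ i
  obtain ⟨S, hS⟩ := (CStarAlgebra.nonneg_iff_eq_star_mul_self).1 hP.posSemidef.nonneg
  have hu : IsUnit S := by
    have := hP.isUnit
    rw [hS, Matrix.isUnit_iff_isUnit_det, Matrix.det_mul] at this
    exact (Matrix.isUnit_iff_isUnit_det _).2 (isUnit_of_mul_isUnit_right this)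
  obtain ⟨⟨S, T, h1, h2⟩, rfl⟩ := hu
  exact ⟨S, T, h1, h2, hS⟩

end Structure

open Matrix in
/-- A finite-dimensional C⋆-algebra is a finite product of full matrix algebras. -/
theorem exists_starAlgEquiv_pi_matrix (F : Type*) [CStarAlgebra F] [FiniteDimensional ℂ F] :
    ∃ (n : ℕ) (d : Fin n → ℕ),
      Nonempty (F ≃⋆ₐ[ℂ] ((i : Fin n) → Matrix (Fin (d i)) (Fin (d i)) ℂ)) := by
  have := isSemisimpleRing_of_finiteDimensional (F := F)
  obtain ⟨n, d, hd, ⟨Ψ⟩⟩ := IsSemisimpleRing.exists_algEquiv_pi_matrix_of_isAlgClosed ℂ F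
  choose S T h1 h2 h3 using exists_sqrt_gram Ψ
  have hinj : ∀ (M : (i : Fin n) → Matrix (Fin (d i)) (Fin (d i)) ℂ) i,
      T i * (S i * M i * T i) * S i = M i := by
    intro M i
    calc T i * (S i * M i * T i) * S i = (T i * S i) * M i * (T i * S i) := by
          simp only [mul_assoc]
      _ = M i := by rw [h2, one_mul, mul_one]
  let C : ((i : Fin n) → Matrix (Fin (d i)) (Fin (d i)) ℂ) ≃ₐ[ℂ]
      ((i : Fin n) → Matrix (Fin (d i)) (Fin (d i)) ℂ) :=
    AlgEquiv.ofBijective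
      (AlgHom.ofLinearMap
        { toFun := fun M i => S i * M i * T i
          map_add' := fun M N => by ext1 i; simp [mul_add, add_mul]
          map_smul' := fun c M => by ext1 i; simp }
        (by ext1 i; simp [h1])
        (fun M N => by
          ext1 i
          calc S i * (M i * N i) * T i = S i * M i * 1 * N i * T i := by
                simp only [mul_assoc, one_mul]
            _ = S i * M i * T i * (S i * N i * T i) := by rw [← h2 i]; simp only [mul_assoc]))
      ⟨fun M N h => by
          ext1 i
          rw [← hinj M i, ← hinj N i]
          exact congr_arg (fun X => T i * X * S i) (congr_fun h i),
        fun M => ⟨fun i => T i * M i * S i, by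
          ext1 i
          change S i * (T i * M i * S i) * T i = M i
          calc S i * (T i * M i * S i) * T i = (S i * T i) * M i * (S i * T i) := by
                simp only [mul_assoc]
            _ = M i := by rw [h1, one_mul, mul_one]⟩⟩
  refine ⟨n, d, ⟨StarAlgEquiv.ofAlgEquiv (Ψ.trans C) fun x => ?_⟩⟩
  ext1 i
  change S i * Ψ (star x) i * T i = (S i * Ψ x i * T i)ᴴ
  have h4 := gram_mul Ψ (star x) i
  rw [star_star, h3] at h4
  have h5 : (T i)ᴴ * (S i)ᴴ = 1 := by rw [← conjTranspose_mul, h1, conjTranspose_one]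
  rw [conjTranspose_mul, conjTranspose_mul]
  calc S i * Ψ (star x) i * T i
      = (T i)ᴴ * ((S i)ᴴ * S i * Ψ (star x) i) * T i := by
        rw [← one_mul (S i * _ * T i), ← h5]; simp only [mul_assoc]
    _ = (T i)ᴴ * ((Ψ x i)ᴴ * (S i)ᴴ) * (S i * T i) := by rw [h4]; simp only [mul_assoc]
    _ = _ := by rw [h1, mul_one]

end CUPath

namespace CUPath

section Combinatorics

variable {ι : Type*} [Fintype ι]

lemma exists_shift_of_spread (m : ℕ) : ∀ θ : ι → ℝ, (∀ k l, θ k - θ l ≤ 2 * Real.pi) →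
    ∑ k, θ k = 2 * Real.pi * m → ∃ z : ι → ℤ, ∑ k, (θ k + 2 * Real.pi * z k) = 0 ∧
      ∀ k l, (θ k + 2 * Real.pi * z k) - (θ l + 2 * Real.pi * z l) ≤ 2 * Real.pi := by
  classical
  induction m with
  | zero =>
    intro θ h1 h2
    exact ⟨0, by simpa using h2, by simpa using h1⟩
  | succ m ih =>
    intro θ h1 h2
    have hne : Nonempty ι := by
      by_contra h
      rw [not_nonempty_iff] at h
      simp only [Finset.univ_eq_empty, Finset.sum_empty] at h2
      have : 0 < 2 * Real.pi * ((m + 1 : ℕ) : ℝ) := by positivity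
      linarith
    obtain ⟨p, hp⟩ := Finite.exists_max θ
    obtain ⟨z, hz1, hz2⟩ := ih (fun k => if k = p then θ k - 2 * Real.pi else θ k) (by
        intro k l
        have := h1 k l
        have := h1 p l
        have := h1 k p
        have := hp k
        have := Real.pi_pos
        split_ifs with h3 h4 h4
        · linarith
        · subst h3; linarith
        · subst h4; linarith
        · assumption) (by
        have : ∀ k, (if k = p then θ k - 2 * Real.pi else θ k)
            = θ k - if k = p then 2 * Real.pi else 0 := by
          intro k; split_ifs <;> simp
        simp only [this, Finset.sum_sub_distrib, h2, Finset.sum_ite_eq', Finset.mem_univ, if_true]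
        push_cast; ring)
    have key : ∀ k, (if k = p then θ k - 2 * Real.pi else θ k) + 2 * Real.pi * z k
        = θ k + 2 * Real.pi * ((z k - if k = p then 1 else 0 : ℤ) : ℝ) := by
      intro k; split_ifs <;> push_cast <;> ring
    refine ⟨fun k => z k - if k = p then 1 else 0, ?_, ?_⟩
    · simpa only [key] using hz1
    · simpa only [key] using hz2

lemma exists_shift (m : ℤ) (θ : ι → ℝ) (h : ∑ k, θ k = 2 * Real.pi * m) :
    ∃ z : ι → ℤ, ∑ k, (θ k + 2 * Real.pi * z k) = 0 ∧
      ∀ k l, (θ k + 2 * Real.pi * z k) - (θ l + 2 * Real.pi * z l) ≤ 2 * Real.pi := by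
  have hpi := Real.two_pi_pos
  let y : ι → ℤ := fun k => - toIcoDiv hpi 0 (θ k)
  have hy : ∀ k, θ k + 2 * Real.pi * y k = toIcoMod hpi 0 (θ k) := by
    intro k
    rw [toIcoMod, zsmul_eq_mul]
    simp only [y]
    push_cast
    ring
  have hb : ∀ k, 0 ≤ θ k + 2 * Real.pi * y k ∧ θ k + 2 * Real.pi * y k < 2 * Real.pi := by
    intro k
    rw [hy]
    simpa using toIcoMod_mem_Ico hpi 0 (θ k)
  have hs : ∑ k, (θ k + 2 * Real.pi * y k) = 2 * Real.pi * ((m + ∑ k, y k : ℤ) : ℝ) := by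
    rw [Finset.sum_add_distrib, h, ← Finset.mul_sum]
    push_cast; ring
  have hnn : 0 ≤ m + ∑ k, y k := by
    have : 0 ≤ ∑ k, (θ k + 2 * Real.pi * y k) := Finset.sum_nonneg fun k _ => (hb k).1
    rw [hs] at this
    exact_mod_cast nonneg_of_mul_nonneg_right this hpi
  obtain ⟨N, hN⟩ := Int.eq_ofNat_of_zero_le hnn
  obtain ⟨z, hz1, hz2⟩ := exists_shift_of_spread N (fun k => θ k + 2 * Real.pi * y k)
    (fun k l => by linarith [hb k, hb l]) (by rw [hs, hN]; norm_cast)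
  have key : ∀ k, θ k + 2 * Real.pi * y k + 2 * Real.pi * z k
      = θ k + 2 * Real.pi * ((y k + z k : ℤ) : ℝ) := by
    intro k; push_cast; ring
  refine ⟨fun k => y k + z k, ?_, ?_⟩
  · simpa only [key] using hz1
  · simpa only [key] using hz2

lemma exists_perm_of_card_fiber_eq {α : Type*} [DecidableEq α] {f g : ι → α}
    (h : ∀ x, (Finset.univ.filter fun k => f k = x).card
      = (Finset.univ.filter fun k => g k = x).card) :
    ∃ τ : Equiv.Perm ι, ∀ k, g (τ k) = f k := by
  have e : ∀ c, Nonempty ({a // f a = c} ≃ {b // g b = c}) := by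
    intro c
    rw [← Fintype.card_eq, Fintype.card_subtype, Fintype.card_subtype]
    exact h c
  exact ⟨Equiv.ofFiberEquiv fun c => (e c).some, fun k => Equiv.ofFiberEquiv_map _ k⟩

lemma exists_perm_of_exp_eq {θ θ' : ι → ℝ} (h1 : ∀ k l, θ k - θ l ≤ 2 * Real.pi)
    (h1' : ∀ k l, θ' k - θ' l ≤ 2 * Real.pi) (h2 : ∑ k, θ k = 0) (h2' : ∑ k, θ' k = 0)
    (τ : Equiv.Perm ι) (z : ι → ℤ) (h3 : ∀ k, θ' (τ k) = θ k + 2 * Real.pi * z k) :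
    ∃ ρ : Equiv.Perm ι, ∀ k, θ' (ρ k) = θ k := by
  classical
  have hpi := Real.pi_pos
  have hz : ∑ k, z k = 0 := by
    have : ∑ k, θ' (τ k) = ∑ k, θ' k := Equiv.sum_comp τ θ'
    simp only [h3, Finset.sum_add_distrib, ← Finset.mul_sum, h2, h2', zero_add] at this
    have h4 : ∑ k, (z k : ℝ) = 0 := by
      rcases mul_eq_zero.1 this with h | h
      · linarith
      · exact h
    exact_mod_cast h4
  by_cases h0 : ∀ k, z k = 0
  · exact ⟨τ, fun k => by rw [h3, h0]; simp⟩
  have hpos : ∃ p, 0 < z p := by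
    by_contra! h
    exact h0 fun k => (Finset.sum_eq_zero_iff_of_nonpos fun i _ => h i).1 hz k (Finset.mem_univ k)
  have hneg : ∃ q, z q < 0 := by
    by_contra! h
    exact h0 fun k => (Finset.sum_eq_zero_iff_of_nonneg fun i _ => h i).1 hz k (Finset.mem_univ k)
  have key : ∀ k l, 0 < z k → z l < 0 → z k = 1 ∧ z l = -1 ∧ θ l = θ k + 2 * Real.pi := by
    intro k l hk hl
    have e1 := h1' (τ k) (τ l)
    rw [h3, h3] at e1
    have e2 := h1 l k
    have e3 : (z k : ℝ) - z l ≤ 2 := by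
      by_contra! hc
      have : 2 * Real.pi * 2 < 2 * Real.pi * ((z k : ℝ) - z l) :=
        mul_lt_mul_of_pos_left hc (by positivity)
      linarith
    have e4 : z k - z l ≤ 2 := by exact_mod_cast e3
    have e5 : z k = 1 := by omega
    have e6 : z l = -1 := by omega
    refine ⟨e5, e6, ?_⟩
    rw [e5, e6] at e1
    push_cast at e1
    linarith
  obtain ⟨p, hp⟩ := hpos
  obtain ⟨q, hq⟩ := hneg
  have hval : ∀ k, (z k = 0) ∨ (z k = 1 ∧ θ k = θ p) ∨ (z k = -1 ∧ θ k = θ p + 2 * Real.pi) := by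
    intro k
    rcases lt_trichotomy (z k) 0 with h | h | h
    · exact Or.inr (Or.inr ⟨(key p k hp h).2.1, (key p k hp h).2.2⟩)
    · exact Or.inl h
    · have e1 := key k q h hq
      have e2 := key p q hp hq
      exact Or.inr (Or.inl ⟨e1.1, by linarith [e1.2.2, e2.2.2]⟩)
  have hf : ∀ f : ℝ → ℤ, ∑ k, f (θ' k) = ∑ k, f (θ k) := by
    intro f
    rw [← Equiv.sum_comp τ (fun k => f (θ' k)), ← sub_eq_zero, ← Finset.sum_sub_distrib]
    have : ∀ k, f (θ' (τ k)) - f (θ k) = z k * (f (θ p + 2 * Real.pi) - f (θ p)) := by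
      intro k
      rcases hval k with h | ⟨h, h'⟩ | ⟨h, h'⟩
      · simp [h3, h]
      · simp [h3, h, h']
      · rw [h3, h, h']
        have : θ p + 2 * Real.pi + 2 * Real.pi * ((-1 : ℤ) : ℝ) = θ p := by push_cast; ring
        rw [this]; ring
    simp only [this, ← Finset.sum_mul, hz, zero_mul]
  refine exists_perm_of_card_fiber_eq fun x => ?_
  have := hf fun y => if y = x then 1 else 0
  simp only [Finset.sum_boole] at this
  exact_mod_cast this.symm

end Combinatorics

end CUPath

namespace CUPath

open Matrix
open scoped CStarAlgebra

section Diag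

variable {F : Type*} [CStarAlgebra F] {n : ℕ} {d : Fin n → ℕ}
  (Φ : F ≃⋆ₐ[ℂ] ((i : Fin n) → Matrix (Fin (d i)) (Fin (d i)) ℂ))

/-- The diagonal embedding of the maximal abelian subalgebra of block-diagonal matrices,
conjugated by the unitary `V`. -/
def diagHom (V : unitary F) : ((i : Fin n) → Fin (d i) → ℂ) →⋆ₐ[ℂ] F where
  toFun θ := V * Φ.symm (fun i => diagonal (θ i)) * star (V : F)
  map_one' := by
    have : (fun i => diagonal ((1 : (i : Fin n) → Fin (d i) → ℂ) i)) =
        (1 : (i : Fin n) → Matrix (Fin (d i)) (Fin (d i)) ℂ) := by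
      ext1 i; simp [Pi.one_def]
    rw [this, map_one, mul_one, Unitary.mul_star_self_of_mem V.2]
  map_mul' θ η := by
    have : (fun i => diagonal ((θ * η) i)) = (fun i => diagonal (θ i)) *
        (fun i => diagonal (η i)) := by
      ext1 i; simp [Matrix.diagonal_mul_diagonal, Pi.mul_def]
    rw [this, map_mul]
    calc (V : F) * (Φ.symm (fun i => diagonal (θ i)) * Φ.symm (fun i => diagonal (η i))) * star ↑V
        = V * Φ.symm (fun i => diagonal (θ i)) * 1 * Φ.symm (fun i => diagonal (η i)) * star ↑V := by
          simp only [mul_assoc, one_mul]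
      _ = _ := by rw [← Unitary.coe_star_mul_self V]; simp only [mul_assoc]
  map_zero' := by
    have : (fun i => diagonal ((0 : (i : Fin n) → Fin (d i) → ℂ) i)) =
        (0 : (i : Fin n) → Matrix (Fin (d i)) (Fin (d i)) ℂ) := by
      ext1 i; simp
    rw [this, map_zero, mul_zero, zero_mul]
  map_add' θ η := by
    have : (fun i => diagonal ((θ + η) i)) = (fun i => diagonal (θ i)) +
        (fun i => diagonal (η i)) := by
      ext1 i; simp [Matrix.diagonal_add]
    rw [this, map_add, mul_add, add_mul]
  commutes' c := by
    have : (fun i => diagonal ((algebraMap ℂ ((i : Fin n) → Fin (d i) → ℂ) c) i)) =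
        c • (1 : (i : Fin n) → Matrix (Fin (d i)) (Fin (d i)) ℂ) := by
      ext i k l; simp [Matrix.diagonal_apply, Matrix.one_apply]
    rw [this, map_smul, map_one, mul_smul_comm, smul_mul_assoc, mul_one,
      Unitary.mul_star_self_of_mem V.2, Algebra.algebraMap_eq_smul_one]
  map_star' θ := by
    have : (fun i => diagonal ((star θ) i)) = star (fun i => diagonal (θ i)) := by
      ext1 i; simp [Matrix.star_eq_conjTranspose]
    rw [this, map_star]
    simp [mul_assoc]

lemma diagHom_apply (V : unitary F) (θ : (i : Fin n) → Fin (d i) → ℂ) :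
    diagHom Φ V θ = V * Φ.symm (fun i => diagonal (θ i)) * star (V : F) := rfl

lemma continuous_diagHom (V : unitary F) : Continuous (diagHom Φ V) :=
  map_continuous (diagHom Φ V)

lemma norm_diagHom_le (V : unitary F) (θ : (i : Fin n) → Fin (d i) → ℂ) :
    ‖diagHom Φ V θ‖ ≤ ‖θ‖ :=
  NonUnitalStarAlgHom.norm_apply_le (diagHom Φ V) θ

lemma block_diagHom (V : unitary F) (θ : (i : Fin n) → Fin (d i) → ℂ) (i : Fin n) :
    Φ (diagHom Φ V θ) i = Φ V i * diagonal (θ i) * star (Φ V i) := by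
  rw [diagHom_apply, map_mul, map_mul, map_star, Φ.apply_symm_apply]
  rfl

lemma star_block_mul_block (V : unitary F) (i : Fin n) : star (Φ V i) * Φ V i = 1 := by
  have := congr_fun (congr_arg Φ (Unitary.coe_star_mul_self V)) i
  rwa [map_mul, map_star, map_one] at this

lemma trace_block_diagHom (V : unitary F) (θ : (i : Fin n) → Fin (d i) → ℂ) (i : Fin n) :
    (Φ (diagHom Φ V θ) i).trace = ∑ k, θ i k := by
  rw [block_diagHom, Matrix.trace_mul_comm, ← mul_assoc, star_block_mul_block, one_mul,
    Matrix.trace_diagonal]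

lemma charpoly_block_diagHom (V : unitary F) (θ : (i : Fin n) → Fin (d i) → ℂ) (i : Fin n) :
    (Φ (diagHom Φ V θ) i).charpoly = ∏ k, (Polynomial.X - Polynomial.C (θ i k)) := by
  rw [block_diagHom, mul_assoc, Matrix.charpoly_mul_comm, mul_assoc, star_block_mul_block, mul_one,
    Matrix.charpoly_diagonal]

lemma det_block_diagHom (V : unitary F) (θ : (i : Fin n) → Fin (d i) → ℂ) (i : Fin n) :
    (Φ (diagHom Φ V θ) i).det = ∏ k, θ i k := by
  rw [block_diagHom, Matrix.det_mul_comm, ← mul_assoc, star_block_mul_block, one_mul,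
    Matrix.det_diagonal]

lemma uexp_diagHom (V : unitary F) (θ : (i : Fin n) → Fin (d i) → ℂ) :
    uexp (diagHom Φ V θ) = diagHom Φ V (fun i k => Complex.exp (Complex.I * θ i k)) := by
  rw [← map_uexp (diagHom Φ V) (continuous_diagHom Φ V)]
  let _ : (i : Fin n) → NormedAlgebra ℚ (Fin (d i) → ℂ) := fun i => .restrictScalars ℚ ℂ _
  let _ : NormedAlgebra ℚ ℂ := .restrictScalars ℚ ℂ ℂ
  congr 1
  ext i k
  rw [uexp, Pi.coe_exp, Pi.coe_exp, Complex.exp_eq_exp_ℂ]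
  rfl

lemma isSelfAdjoint_diagHom (V : unitary F) (θ : (i : Fin n) → Fin (d i) → ℝ) :
    IsSelfAdjoint (diagHom Φ V (fun i k => (θ i k : ℂ))) := by
  refine IsSelfAdjoint.map ?_ _
  ext i k
  simp

lemma exists_eq_diagHom {h : F} (hh : IsSelfAdjoint h) :
    ∃ (V : unitary F) (θ : (i : Fin n) → Fin (d i) → ℝ),
      h = diagHom Φ V (fun i k => (θ i k : ℂ)) := by
  have hH : ∀ i, (Φ h i).IsHermitian := fun i => by
    have := congr_fun (congr_arg Φ hh.star_eq) i
    rwa [map_star] at this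
  let W : (i : Fin n) → Matrix (Fin (d i)) (Fin (d i)) ℂ := fun i => (hH i).eigenvectorUnitary
  have hW : W ∈ unitary ((i : Fin n) → Matrix (Fin (d i)) (Fin (d i)) ℂ) := by
    constructor
    · ext1 i; exact Unitary.coe_star_mul_self (hH i).eigenvectorUnitary
    · ext1 i; exact Unitary.coe_mul_star_self (hH i).eigenvectorUnitary
  refine ⟨⟨Φ.symm W, Unitary.map_mem _ hW⟩, fun i => (hH i).eigenvalues, ?_⟩
  refine EquivLike.injective Φ ?_
  ext1 i
  rw [block_diagHom]
  simp only [Φ.apply_symm_apply]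
  exact (hH i).spectral_theorem

end Diag

end CUPath

namespace CUPath

open Matrix
open scoped CStarAlgebra

section Log

variable {F : Type*} [CStarAlgebra F] {n : ℕ} {d : Fin n → ℕ}
  (Φ : F ≃⋆ₐ[ℂ] ((i : Fin n) → Matrix (Fin (d i)) (Fin (d i)) ℂ))

lemma finite_spectrum [FiniteDimensional ℂ F] (x : F) : (spectrum ℂ x).Finite := by
  obtain ⟨n, d, ⟨Φ⟩⟩ := exists_starAlgEquiv_pi_matrix F
  rw [← AlgEquiv.spectrum_eq Φ x, Pi.spectrum_eq]
  exact Set.finite_iUnion fun i => Matrix.finite_spectrum _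

lemma exists_uexp_eq [FiniteDimensional ℂ F] {u : F} (hu : u ∈ unitary F) :
    ∃ h : F, IsSelfAdjoint h ∧ uexp h = u ∧ ∀ y, Commute u y → Commute (star u) y →
      Commute h y := by
  have hc : ContinuousOn Complex.arg (spectrum ℂ u) := (finite_spectrum u).continuousOn _
  have hn : IsStarNormal u :=
    ⟨by rw [commute_iff_eq, Unitary.star_mul_self_of_mem hu, Unitary.mul_star_self_of_mem hu]⟩
  refine ⟨cfc (fun z => (Complex.arg z : ℂ)) u, IsSelfAdjoint.cfc_arg u, ?_,
    fun y h1 h2 => h1.cfc h2 _⟩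
  rw [uexp, ← CFC.exp_eq_normedSpace_exp (𝕜 := ℂ), ← cfc_comp_smul .., ← cfc_comp' ..]
  · conv_rhs => rw [← cfc_id' ℂ u]
    refine cfc_congr fun y hy => ?_
    have hy₁ : ‖y‖ = 1 := spectrum.norm_eq_one_of_unitary hu hy
    have : Complex.I * y.arg = Complex.log y :=
      Complex.ext (by simp [Complex.log_re, hy₁]) (by simp [Complex.log_im])
    simpa [← Complex.exp_eq_exp_ℂ, this] using
      Complex.exp_log (by simp [← norm_pos_iff, hy₁])

/-- `h` is a self-adjoint logarithm of `u` with blockwise trace zero and such that the eigenvalues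
within each block differ by at most `2π`. -/
structure IsLog (u h : F) : Prop where
  isSelfAdjoint : IsSelfAdjoint h
  uexp_eq : uexp h = u
  trace_eq : ∀ i, (Φ h i).trace = 0
  spread_le : ∀ (V : unitary F) i k l,
    (Φ (star (V : F) * h * V) i k k).re - (Φ (star (V : F) * h * V) i l l).re ≤ 2 * Real.pi

lemma star_mul_diagHom_mul (V : unitary F) (θ : (i : Fin n) → Fin (d i) → ℂ) (i : Fin n) :
    Φ (star (V : F) * diagHom Φ V θ * V) i = diagonal (θ i) := by
  rw [map_mul, map_mul, map_star, Pi.mul_apply, Pi.mul_apply, block_diagHom, Pi.star_apply]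
  calc star (Φ V i) * (Φ V i * diagonal (θ i) * star (Φ V i)) * Φ V i
      = (star (Φ V i) * Φ V i) * diagonal (θ i) * (star (Φ V i) * Φ V i) := by
        simp only [mul_assoc]
    _ = _ := by rw [star_block_mul_block, one_mul, mul_one]

lemma sum_normSq_col {m : ℕ} {U : Matrix (Fin m) (Fin m) ℂ} (hU : star U * U = 1) (k : Fin m) :
    ∑ p, Complex.normSq (U p k) = 1 := by
  have := congr_fun (congr_fun hU k) k
  rw [Matrix.mul_apply, Matrix.one_apply_eq] at this
  simp only [Matrix.star_apply] at this
  have h2 : ∀ p, star (U p k) * U p k = (Complex.normSq (U p k) : ℂ) := fun p =>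
    Complex.normSq_eq_conj_mul_self.symm
  simp only [h2] at this
  exact_mod_cast this

lemma conj_diagonal_apply_re {m : ℕ} (U : Matrix (Fin m) (Fin m) ℂ) (θ : Fin m → ℝ) (k : Fin m) :
    ((star U * diagonal (fun p => (θ p : ℂ)) * U) k k).re
      = ∑ p, Complex.normSq (U p k) * θ p := by
  rw [Matrix.mul_apply, Complex.re_sum]
  refine Finset.sum_congr rfl fun p _ => ?_
  rw [Matrix.mul_diagonal, Matrix.star_apply, mul_right_comm]
  have : star (U p k) * U p k = (Complex.normSq (U p k) : ℂ) :=
    Complex.normSq_eq_conj_mul_self.symm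
  rw [this, ← Complex.ofReal_mul, Complex.ofReal_re]

lemma isLog_diagHom (V : unitary F) {θ : (i : Fin n) → Fin (d i) → ℝ}
    (h1 : ∀ i, ∑ k, θ i k = 0) (h2 : ∀ i k l, θ i k - θ i l ≤ 2 * Real.pi) :
    IsLog Φ (uexp (diagHom Φ V (fun i k => (θ i k : ℂ))))
      (diagHom Φ V (fun i k => (θ i k : ℂ))) where
  isSelfAdjoint := isSelfAdjoint_diagHom Φ V θ
  uexp_eq := rfl
  trace_eq i := by
    rw [trace_block_diagHom, ← Complex.ofReal_sum, h1, Complex.ofReal_zero]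
  spread_le W i k l := by
    have hW := star_block_mul_block Φ (star V * W) i
    set U := Φ ((star V * W : unitary F) : F) i with hU
    have e : Φ (star (W : F) * diagHom Φ V (fun i k => (θ i k : ℂ)) * W) i
        = star U * diagonal (fun p => (θ i p : ℂ)) * U := by
      rw [map_mul, map_mul, map_star, Pi.mul_apply, Pi.mul_apply, block_diagHom, Pi.star_apply,
        hU]
      simp only [Submonoid.coe_mul, Unitary.coe_star, map_mul, map_star, Pi.mul_apply,
        Pi.star_apply, star_mul, star_star, mul_assoc]
    rw [e, conj_diagonal_apply_re, conj_diagonal_apply_re]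
    have hne : Nonempty (Fin (d i)) := ⟨k⟩
    obtain ⟨p, hp⟩ := Finite.exists_max (θ i)
    obtain ⟨q, hq⟩ := Finite.exists_min (θ i)
    have b1 : ∑ r, Complex.normSq (U r k) * θ i r ≤ θ i p := by
      calc ∑ r, Complex.normSq (U r k) * θ i r ≤ ∑ r, Complex.normSq (U r k) * θ i p :=
            Finset.sum_le_sum fun r _ =>
              mul_le_mul_of_nonneg_left (hp r) (Complex.normSq_nonneg _)
        _ = θ i p := by rw [← Finset.sum_mul, sum_normSq_col hW, one_mul]
    have b2 : θ i q ≤ ∑ r, Complex.normSq (U r l) * θ i r := by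
      calc θ i q = ∑ r, Complex.normSq (U r l) * θ i q := by
            rw [← Finset.sum_mul, sum_normSq_col hW, one_mul]
        _ ≤ _ := Finset.sum_le_sum fun r _ =>
              mul_le_mul_of_nonneg_left (hq r) (Complex.normSq_nonneg _)
    linarith [h2 i p q]

variable {Φ}

lemma IsLog.exists_eq_diagHom {u h : F} (hh : IsLog Φ u h) :
    ∃ (V : unitary F) (θ : (i : Fin n) → Fin (d i) → ℝ),
      h = diagHom Φ V (fun i k => (θ i k : ℂ)) ∧
      u = diagHom Φ V (fun i k => Complex.exp (Complex.I * θ i k)) ∧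
      (∀ i, ∑ k, θ i k = 0) ∧ (∀ i k l, θ i k - θ i l ≤ 2 * Real.pi) := by
  obtain ⟨V, θ, rfl⟩ := CUPath.exists_eq_diagHom Φ hh.isSelfAdjoint
  refine ⟨V, θ, rfl, ?_, fun i => ?_, fun i k l => ?_⟩
  · rw [← hh.uexp_eq, uexp_diagHom]
  · have := hh.trace_eq i
    rw [trace_block_diagHom, ← Complex.ofReal_sum] at this
    exact_mod_cast this
  · simpa [star_mul_diagHom_mul] using hh.spread_le V i k l

lemma IsLog.abs_le {ι : Type*} [Fintype ι] {θ : ι → ℝ} (h1 : ∑ k, θ k = 0)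
    (h2 : ∀ k l, θ k - θ l ≤ 2 * Real.pi) (k : ι) : |θ k| ≤ 2 * Real.pi := by
  have a : ∃ l, θ l ≤ 0 := by
    by_contra! h
    exact absurd h1 (Finset.sum_pos (fun i _ => h i) ⟨k, Finset.mem_univ k⟩).ne'
  have b : ∃ l, 0 ≤ θ l := by
    by_contra! h
    exact absurd h1 (Finset.sum_neg (fun i _ => h i) ⟨k, Finset.mem_univ k⟩).ne
  obtain ⟨l, hl⟩ := a
  obtain ⟨m, hm⟩ := b
  rw [_root_.abs_le]
  constructor <;> linarith [h2 k l, h2 m k]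

lemma IsLog.norm_le {u h : F} (hh : IsLog Φ u h) : ‖h‖ ≤ 2 * Real.pi := by
  obtain ⟨V, θ, rfl, -, h1, h2⟩ := hh.exists_eq_diagHom
  refine (norm_diagHom_le Φ V _).trans ?_
  have hpi := Real.two_pi_pos.le
  rw [pi_norm_le_iff_of_nonneg hpi]
  intro i
  rw [pi_norm_le_iff_of_nonneg hpi]
  intro k
  rw [Complex.norm_real]
  exact IsLog.abs_le (h1 i) (h2 i) k

variable (Φ) in
lemma exists_isLog [FiniteDimensional ℂ F] {u : F} (hu : u ∈ unitary F)
    (hdet : ∀ i, (Φ u i).det = 1) :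
    ∃ h, IsLog Φ u h := by
  obtain ⟨h, hsa, hexp, -⟩ := exists_uexp_eq hu
  obtain ⟨V, θ, rfl⟩ := CUPath.exists_eq_diagHom Φ hsa
  have hm : ∀ i, ∃ m : ℤ, ∑ k, θ i k = 2 * Real.pi * m := by
    intro i
    have h1 := hdet i
    rw [← hexp, uexp_diagHom, det_block_diagHom, ← Complex.exp_sum, Complex.exp_eq_one_iff] at h1
    obtain ⟨m, hm⟩ := h1
    refine ⟨m, ?_⟩
    rw [← Finset.mul_sum, ← Complex.ofReal_sum] at hm
    have := congr_arg Complex.im hm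
    simp at this
    linarith
  choose m hm using hm
  choose z hz1 hz2 using fun i => exists_shift (m i) (θ i) (hm i)
  have e : u = uexp (diagHom Φ V fun i k => ((θ i k + 2 * Real.pi * z i k : ℝ) : ℂ)) := by
    rw [← hexp, uexp_diagHom, uexp_diagHom]
    congr 1
    ext i k
    rw [Complex.exp_eq_exp_iff_exists_int]
    refine ⟨-z i k, ?_⟩
    push_cast
    ring
  rw [e]
  exact ⟨_, isLog_diagHom Φ V hz1 hz2⟩

end Log

end CUPath

namespace CUPath

open Matrix
open scoped CStarAlgebra

/-- The self-commutator `x x⋆ - x⋆ x`. -/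
def selfComm {A : Type*} [NonUnitalRing A] [StarRing A] (x : A) : A := x * star x - star x * x

section Units

variable {F : Type*} [CStarAlgebra F] {n : ℕ} {d : Fin n → ℕ}
  (Φ : F ≃⋆ₐ[ℂ] ((i : Fin n) → Matrix (Fin (d i)) (Fin (d i)) ℂ))

/-- The matrix units, conjugated by the unitary `V`. -/
def matUnit (V : unitary F) (i : Fin n) (k l : Fin (d i)) : F :=
  V * Φ.symm (Pi.single i (Matrix.single k l 1)) * star (V : F)

lemma diagHom_mul_matUnit_mul (V : unitary F) (a b : (i : Fin n) → Fin (d i) → ℂ) (i : Fin n)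
    (k l : Fin (d i)) :
    diagHom Φ V a * matUnit Φ V i k l * diagHom Φ V b = (a i k * b i l) • matUnit Φ V i k l := by
  have e : (fun i => diagonal (a i)) * Pi.single i (Matrix.single k l (1 : ℂ))
      * (fun i => diagonal (b i)) = (a i k * b i l) •
        (Pi.single i (Matrix.single k l 1) : (i : Fin n) → Matrix (Fin (d i)) (Fin (d i)) ℂ) := by
    ext j
    by_cases hj : j = i
    · subst hj
      simp only [Pi.mul_apply, Pi.single_eq_same, Pi.smul_apply, Matrix.smul_apply, smul_eq_mul]
      rw [Matrix.mul_diagonal, Matrix.diagonal_mul]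
      rename_i p q
      by_cases hp : k = p
      · by_cases hq : l = q
        · subst hp hq; simp
        · simp [hq]
      · simp [hp]
    · simp [hj]
  have hV := Unitary.coe_star_mul_self V
  calc diagHom Φ V a * matUnit Φ V i k l * diagHom Φ V b
      = V * (Φ.symm (fun i => diagonal (a i)) * (star (V : F) * V) *
          Φ.symm (Pi.single i (Matrix.single k l 1)) * (star (V : F) * V) *
          Φ.symm (fun i => diagonal (b i))) * star (V : F) := by
        rw [diagHom_apply, diagHom_apply, matUnit]; simp only [mul_assoc]
    _ = _ := by
        rw [hV, mul_one, mul_one, ← map_mul, ← map_mul, e, map_smul, matUnit, mul_smul_comm,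
          smul_mul_assoc]

lemma star_matUnit (V : unitary F) (i : Fin n) (k l : Fin (d i)) :
    star (matUnit Φ V i k l) = matUnit Φ V i l k := by
  have : star (Pi.single i (Matrix.single k l (1 : ℂ)) :
      (i : Fin n) → Matrix (Fin (d i)) (Fin (d i)) ℂ) = Pi.single i (Matrix.single l k 1) := by
    ext j
    by_cases hj : j = i
    · subst hj
      rw [Pi.star_apply, Pi.single_eq_same, Pi.single_eq_same, Matrix.star_eq_conjTranspose,
        Matrix.conjTranspose_single, star_one]
    · simp [hj]
  rw [matUnit, star_mul, star_mul, star_star, ← map_star, this, matUnit, mul_assoc]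

lemma matUnit_mul_matUnit (V : unitary F) (i : Fin n) (k l m : Fin (d i)) :
    matUnit Φ V i k l * matUnit Φ V i l m = matUnit Φ V i k m := by
  have hV := Unitary.coe_star_mul_self V
  calc matUnit Φ V i k l * matUnit Φ V i l m
      = V * (Φ.symm (Pi.single i (Matrix.single k l 1)) * (star (V : F) * V) *
          Φ.symm (Pi.single i (Matrix.single l m 1))) * star (V : F) := by
        rw [matUnit, matUnit]; simp only [mul_assoc]
    _ = _ := by
        rw [hV, mul_one, ← map_mul, ← Pi.single_mul, Matrix.single_mul_single_same, one_mul,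
          matUnit]

lemma selfComm_matUnit (V : unitary F) (i : Fin n) (k l : Fin (d i)) :
    selfComm (matUnit Φ V i k l) = matUnit Φ V i k k - matUnit Φ V i l l := by
  rw [selfComm, star_matUnit, matUnit_mul_matUnit, matUnit_mul_matUnit]

lemma diagHom_eq_sum (V : unitary F) (a : (i : Fin n) → Fin (d i) → ℂ) :
    diagHom Φ V a = ∑ i, ∑ k, a i k • matUnit Φ V i k k := by
  have e : (fun i => diagonal (a i)) = ∑ i, ∑ k, a i k •
      (Pi.single i (Matrix.single k k 1) : (i : Fin n) → Matrix (Fin (d i)) (Fin (d i)) ℂ) := by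
    ext j p q
    rw [Finset.sum_apply, Finset.sum_eq_single j]
    · rw [Finset.sum_apply, Matrix.sum_apply]
      simp [Matrix.single_apply, Matrix.diagonal_apply, ite_and]
    · intro b _ hb
      simp [hb.symm]
    · simp
  rw [diagHom_apply, e]
  simp only [map_sum, map_smul, Finset.mul_sum, Finset.sum_mul, mul_smul_comm, smul_mul_assoc]
  rfl

lemma abs_lt_of_ne_zero {ι : Type*} [Fintype ι] {θ : ι → ℝ} (h1 : ∑ k, θ k = 0)
    (h2 : ∀ k l, θ k - θ l ≤ 2 * Real.pi) {k : ι} (hk : θ k ≠ 0) : |θ k| < 2 * Real.pi := by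
  rw [abs_lt]
  rcases hk.lt_or_gt with h | h
  · have : ∃ l, 0 < θ l := by
      by_contra! hc
      exact h.ne ((Finset.sum_eq_zero_iff_of_nonpos fun i _ => hc i).1 h1 k (Finset.mem_univ k))
    obtain ⟨l, hl⟩ := this
    constructor <;> linarith [h2 l k, Real.pi_pos]
  · have : ∃ l, θ l < 0 := by
      by_contra! hc
      exact h.ne' ((Finset.sum_eq_zero_iff_of_nonneg fun i _ => hc i).1 h1 k (Finset.mem_univ k))
    obtain ⟨l, hl⟩ := this
    constructor <;> linarith [h2 k l, Real.pi_pos]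

lemma exp_I_mul_sub_one_ne_zero {x : ℝ} (h0 : x ≠ 0) (h1 : |x| < 2 * Real.pi) :
    Complex.exp (Complex.I * x) - 1 ≠ 0 := by
  rw [sub_ne_zero]
  intro h
  rw [Complex.exp_eq_one_iff] at h
  obtain ⟨m, hm⟩ := h
  have hx : x = m * (2 * Real.pi) := by
    have := congr_arg Complex.im hm
    simpa using this
  have hm0 : m ≠ 0 := by rintro rfl; simp at hx; exact h0 hx
  have : (1 : ℝ) ≤ |(m : ℝ)| := by exact_mod_cast Int.one_le_abs hm0
  rw [hx, abs_mul, abs_of_pos Real.two_pi_pos] at h1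
  nlinarith [Real.two_pi_pos]

variable {Φ}

lemma IsLog.exists_eq_sum {u h : F} (hh : IsLog Φ u h) :
    ∃ (c : (Σ i, Fin (d i)) → ℝ) (m : (Σ i, Fin (d i)) → F),
      h = ∑ r, c r • selfComm ((u - 1) * m r * star (u - 1)) := by
  classical
  obtain ⟨V, θ, rfl, rfl, h1, h2⟩ := hh.exists_eq_diagHom
  set y : (i : Fin n) → Fin (d i) → ℂ := fun i k => Complex.exp (Complex.I * θ i k) - 1 with hy
  have ey : diagHom Φ V (fun i k => Complex.exp (Complex.I * θ i k)) - 1 = diagHom Φ V y := by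
    rw [← map_one (diagHom Φ V), ← map_sub]; rfl
  have hy0 : ∀ i k, θ i k ≠ 0 → y i k ≠ 0 := fun i k hk =>
    exp_I_mul_sub_one_ne_zero hk (abs_lt_of_ne_zero (h1 i) (h2 i) hk)
  have hsum : ∀ i, ∃ k₀ : Fin (d i) → Fin (d i),
      (∀ k, θ i k ≠ 0 → θ i (k₀ k) ≠ 0) ∧
      ∑ k, (θ i k : ℂ) • matUnit Φ V i k k
        = ∑ k, (θ i k : ℂ) • (matUnit Φ V i k k - matUnit Φ V i (k₀ k) (k₀ k)) := by
    intro i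
    by_cases h0 : ∃ p, θ i p ≠ 0
    · obtain ⟨p, hp⟩ := h0
      refine ⟨fun _ => p, fun _ _ => hp, ?_⟩
      simp only [smul_sub, Finset.sum_sub_distrib, ← Finset.sum_smul]
      rw [← Complex.ofReal_sum, h1, Complex.ofReal_zero, zero_smul, sub_zero]
    · push Not at h0
      exact ⟨id, fun k hk => absurd (h0 k) hk, by simp [h0]⟩
  choose k₀ hk₀ hsum using hsum
  refine ⟨fun r => θ r.1 r.2, fun r => ((y r.1 r.2)⁻¹ * (star (y r.1 (k₀ r.1 r.2)))⁻¹) •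
    matUnit Φ V r.1 r.2 (k₀ r.1 r.2), ?_⟩
  rw [diagHom_eq_sum, Fintype.sum_sigma]
  refine Finset.sum_congr rfl fun i _ => ?_
  rw [hsum i]
  refine Finset.sum_congr rfl fun k _ => ?_
  by_cases hk : θ i k = 0
  · simp [hk]
  · have a1 := hy0 i k hk
    have a2 : star (y i (k₀ i k)) ≠ 0 := star_ne_zero.2 (hy0 i _ (hk₀ i k hk))
    rw [ey, ← map_star, mul_smul_comm, smul_mul_assoc, diagHom_mul_matUnit_mul, smul_smul]
    have : (y i k)⁻¹ * (star (y i (k₀ i k)))⁻¹ * (y i k * star y i (k₀ i k)) = 1 := by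
      change (y i k)⁻¹ * (star (y i (k₀ i k)))⁻¹ * (y i k * star (y i (k₀ i k))) = 1
      field_simp
    rw [this, one_smul, selfComm_matUnit, Complex.coe_smul]

lemma IsLog.eq_zero {h : F} (hh : IsLog Φ 1 h) : h = 0 := by
  obtain ⟨c, m, rfl⟩ := hh.exists_eq_sum
  simp [selfComm]

lemma IsLog.conj {u h : F} (hh : IsLog Φ u h) (W : unitary F) :
    IsLog Φ (W * u * star (W : F)) (W * h * star (W : F)) where
  isSelfAdjoint := hh.isSelfAdjoint.conjugate _
  uexp_eq := by
    rw [uexp_conj (Unitary.mul_star_self_of_mem W.2) (Unitary.star_mul_self_of_mem W.2),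
      hh.uexp_eq]
  trace_eq i := by
    rw [map_mul, map_mul, map_star, Pi.mul_apply, Pi.mul_apply, Matrix.trace_mul_comm, ← mul_assoc,
      Pi.star_apply, star_block_mul_block, one_mul, hh.trace_eq]
  spread_le V i k l := by
    have := hh.spread_le (star W * V) i k l
    simpa [mul_assoc] using this

lemma IsLog.exists_conj {u h h' : F} (hh : IsLog Φ u h) (hh' : IsLog Φ u h') :
    ∃ X : unitary F, (X : F) * h * star (X : F) = h' := by
  classical
  obtain ⟨V, θ, rfl, e, h1, h2⟩ := hh.exists_eq_diagHom
  obtain ⟨V', θ', rfl, e', h1', h2'⟩ := hh'.exists_eq_diagHom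
  have hρ : ∀ i, ∃ ρ : Equiv.Perm (Fin (d i)), ∀ k, θ' i (ρ k) = θ i k := by
    intro i
    have hc : ∏ k, (Polynomial.X - Polynomial.C (Complex.exp (Complex.I * θ i k)))
        = ∏ k, (Polynomial.X - Polynomial.C (Complex.exp (Complex.I * θ' i k))) := by
      have a1 := charpoly_block_diagHom Φ V (fun i k => Complex.exp (Complex.I * θ i k)) i
      have a2 := charpoly_block_diagHom Φ V' (fun i k => Complex.exp (Complex.I * θ' i k)) i
      rw [← e] at a1
      rw [← e'] at a2
      exact a1.symm.trans a2
    have hm : (Finset.univ.val.map fun k => Complex.exp (Complex.I * θ i k))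
        = Finset.univ.val.map fun k => Complex.exp (Complex.I * θ' i k) := by
      have := congr_arg Polynomial.roots hc
      rw [Polynomial.roots_prod _ _ (Finset.prod_ne_zero_iff.2 fun k _ =>
        Polynomial.X_sub_C_ne_zero _), Polynomial.roots_prod _ _ (Finset.prod_ne_zero_iff.2
        fun k _ => Polynomial.X_sub_C_ne_zero _)] at this
      simpa [Polynomial.roots_X_sub_C, Multiset.bind_singleton] using this
    obtain ⟨τ, hτ⟩ := exists_perm_of_card_fiber_eq
      (f := fun k => Complex.exp (Complex.I * θ i k))
      (g := fun k => Complex.exp (Complex.I * θ' i k)) fun x => by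
        have := congr_arg (Multiset.count x) hm
        rw [Multiset.count_map, Multiset.count_map] at this
        simpa only [Finset.card_def, Finset.filter_val, eq_comm] using this
    have hz : ∀ k, ∃ z : ℤ, θ' i (τ k) = θ i k + 2 * Real.pi * z := by
      intro k
      obtain ⟨z, hz⟩ := Complex.exp_eq_exp_iff_exists_int.1 (hτ k)
      refine ⟨z, ?_⟩
      have := congr_arg Complex.im hz
      simp at this
      linarith
    choose z hz using hz
    exact exists_perm_of_exp_eq (h2 i) (h2' i) (h1 i) (h1' i) τ z hz
  choose ρ hρ using hρ
  let P : (i : Fin n) → Matrix (Fin (d i)) (Fin (d i)) ℂ :=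
    fun i => Matrix.of fun a b => if (ρ i).symm a = b then 1 else 0
  have hP : P ∈ unitary ((i : Fin n) → Matrix (Fin (d i)) (Fin (d i)) ℂ) := by
    have a : ∀ i, P i * star (P i) = 1 := by
      intro i
      ext a b
      simp [P, Matrix.mul_apply, Matrix.star_apply, Matrix.one_apply, eq_comm]
    constructor
    · ext1 i; exact mul_eq_one_comm.1 (a i)
    · ext1 i; exact a i
  have hPd : Φ.symm P * Φ.symm (fun i => diagonal fun k => (θ i k : ℂ)) * star (Φ.symm P)
      = Φ.symm (fun i => diagonal fun k => (θ' i k : ℂ)) := by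
    rw [← map_star, ← map_mul, ← map_mul]
    congr 1
    ext i a b
    have : θ i ((ρ i).symm a) = θ' i a := by rw [← hρ, Equiv.apply_symm_apply]
    simp only [P, Pi.mul_apply, Pi.star_apply]
    rw [Matrix.mul_apply]
    simp only [Matrix.mul_diagonal, Matrix.star_apply, Matrix.of_apply, Matrix.diagonal_apply]
    simp only [ite_mul, one_mul, zero_mul, Finset.sum_ite_eq, Finset.mem_univ, if_true, this]
    by_cases hab : a = b
    · simp [hab]
    · simp [hab, Ne.symm hab]
  refine ⟨V' * ⟨Φ.symm P, Unitary.map_mem _ hP⟩ * star V, ?_⟩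
  have hV := Unitary.coe_star_mul_self V
  rw [diagHom_apply, diagHom_apply, ← hPd]
  simp only [Submonoid.coe_mul, Unitary.coe_star, star_mul, star_star]
  calc _ = (V' : F) * Φ.symm P * (star (V : F) * V) *
        Φ.symm (fun i => diagonal fun k => (θ i k : ℂ)) * (star (V : F) * V) *
        star (Φ.symm P) * star (V' : F) := by simp only [mul_assoc]
    _ = _ := by rw [hV, mul_one, mul_one]; simp only [mul_assoc]

lemma IsLog.joinedIn [FiniteDimensional ℂ F] {u h h' : F} (hh : IsLog Φ u h)
    (hh' : IsLog Φ u h') : JoinedIn {k | IsLog Φ u k} h h' := by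
  obtain ⟨X, hX⟩ := hh.exists_conj hh'
  have hXu : (X : F) * u * star (X : F) = u := by
    rw [← hh.uexp_eq, ← uexp_conj (Unitary.mul_star_self_of_mem X.2)
      (Unitary.star_mul_self_of_mem X.2), hX, hh'.uexp_eq, hh.uexp_eq]
  have hc : Commute (X : F) u := by
    rw [commute_iff_eq]
    conv_rhs => rw [← hXu]
    rw [mul_assoc, Unitary.star_mul_self_of_mem X.2, mul_one]
  have hc' : Commute (star (X : F)) u := by
    rw [commute_iff_eq]
    conv_lhs => rw [← hXu]
    rw [← mul_assoc, ← mul_assoc, Unitary.star_mul_self_of_mem X.2, one_mul]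
  obtain ⟨y, hy, hyX, hyc⟩ := exists_uexp_eq X.2
  have hyu := hyc u hc hc'
  have hs : ∀ s : ℝ, IsSelfAdjoint (s • y) := fun s => isSelfAdjoint_real_smul hy s
  refine JoinedIn.ofLine (f := fun s : ℝ => uexp (s • y) * h * star (uexp (s • y))) ?_ ?_ ?_ ?_
  · have : Continuous fun s : ℝ => uexp (s • y) :=
      continuous_uexp.comp (continuous_id.smul continuous_const)
    exact ((this.mul continuous_const).mul this.star).continuousOn
  · simp [uexp_zero]
  · simp only [one_smul, hyX, hX]
  · rintro _ ⟨s, -, rfl⟩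
    have := hh.conj ⟨uexp (s • y), uexp_mem_unitary (hs s)⟩
    have e : uexp (s • y) * u * star (uexp (s • y)) = u := by
      have hcu : Commute (uexp (s • y)) u := (commute_uexp_right (hyu.symm.smul_right s)).symm
      rw [hcu.eq, mul_assoc, Unitary.mul_star_self_of_mem (uexp_mem_unitary (hs s)), mul_one]
    simpa only [e, Set.mem_ofPred_eq] using this

end Units

end CUPath

namespace CUPath

open Matrix Topology Filter
open scoped CStarAlgebra

section Local

variable {F : Type*} [CStarAlgebra F] {n : ℕ} {d : Fin n → ℕ}
  (Φ : F ≃⋆ₐ[ℂ] ((i : Fin n) → Matrix (Fin (d i)) (Fin (d i)) ℂ))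

lemma continuous_block [FiniteDimensional ℂ F] (i : Fin n) : Continuous fun x => Φ x i := by
  let f : F →ₗ[ℂ] Matrix (Fin (d i)) (Fin (d i)) ℂ :=
    { toFun := fun x => Φ x i
      map_add' := fun x y => by simp
      map_smul' := fun c x => by simp }
  exact f.continuous_of_finiteDimensional

lemma continuous_selfComm {A : Type*} [NonUnitalCStarAlgebra A] :
    Continuous (selfComm : A → A) :=
  (continuous_id.mul continuous_star).sub (continuous_star.mul continuous_id)

lemma isClosed_isLog [FiniteDimensional ℂ F] : IsClosed {p : F × F | IsLog Φ p.1 p.2} := by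
  have e : {p : F × F | IsLog Φ p.1 p.2} = {p | IsSelfAdjoint p.2} ∩ {p | uexp p.2 = p.1} ∩
      (⋂ i, {p | (Φ p.2 i).trace = 0}) ∩ ⋂ (V : unitary F) (i) (k) (l),
        {p | (Φ (star (V : F) * p.2 * V) i k k).re - (Φ (star (V : F) * p.2 * V) i l l).re
          ≤ 2 * Real.pi} := by
    ext p
    simp only [Set.mem_ofPred_eq, Set.mem_inter_iff, Set.mem_iInter]
    exact ⟨fun h => ⟨⟨⟨h.1, h.2⟩, h.3⟩, h.4⟩, fun h => ⟨h.1.1.1, h.1.1.2, h.1.2, h.2⟩⟩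
  rw [e]
  refine IsClosed.inter (IsClosed.inter (IsClosed.inter ?_ ?_) ?_) ?_
  · exact isClosed_eq continuous_snd.star continuous_snd
  · exact isClosed_eq (continuous_uexp.comp continuous_snd) continuous_fst
  · exact isClosed_iInter fun i => isClosed_eq
      (((continuous_block Φ i).comp continuous_snd).matrix_trace) continuous_const
  · refine isClosed_iInter fun V => isClosed_iInter fun i => isClosed_iInter fun k =>
      isClosed_iInter fun l => isClosed_le ?_ continuous_const
    have : Continuous fun p : F × F => Φ (star (V : F) * p.2 * V) i :=
      (continuous_block Φ i).comp ((continuous_const.mul continuous_snd).mul continuous_const)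
    exact (Complex.continuous_re.comp (this.matrix_elem k k)).sub
      (Complex.continuous_re.comp (this.matrix_elem l l))

lemma eventually_isLog_near [FiniteDimensional ℂ F] (u : F) {η : ℝ} (hη : 0 < η) :
    ∀ᶠ v in 𝓝 u, ∀ h, IsLog Φ v h → ∃ k, IsLog Φ u k ∧ ‖h - k‖ < η := by
  have : ProperSpace F := FiniteDimensional.proper ℂ F
  have hK : IsCompact (Metric.closedBall (0 : F) (2 * Real.pi)) := isCompact_closedBall _ _
  have := hK.eventually_forall_of_forall_eventually (x₀ := u)
    (P := fun v h => IsLog Φ v h → ∃ k, IsLog Φ u k ∧ ‖h - k‖ < η) fun h _ => by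
      by_cases hh : IsLog Φ u h
      · have : ∀ᶠ z : F × F in 𝓝 (u, h), ‖z.2 - h‖ < η := by
          refine (continuous_snd.sub continuous_const).norm.continuousAt.eventually_lt
            continuousAt_const ?_
          simpa using hη
        filter_upwards [this] with z hz _ using ⟨h, hh, hz⟩
      · filter_upwards [(isClosed_isLog Φ).isOpen_compl.mem_nhds
          (show (u, h) ∈ {p : F × F | IsLog Φ p.1 p.2}ᶜ from hh)] with z hz hz'
        exact absurd hz' hz
  filter_upwards [this] with v hv h hh
  exact hv h (by simpa using hh.norm_le) hh

/-- The real span of the self-commutators of the elements of `y F y⋆`. -/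
def commSpan (y : F) : Submodule ℝ F :=
  Submodule.span ℝ (Set.range fun m => selfComm (y * m * star y))

lemma eventually_near_commSpan [FiniteDimensional ℂ F] (u : F) {η : ℝ} (hη : 0 < η) :
    ∀ᶠ v in 𝓝 u, ∀ k, IsLog Φ u k → ∃ k₁ ∈ commSpan (v - 1), ‖k - k₁‖ < η := by
  have : ProperSpace F := FiniteDimensional.proper ℂ F
  have hK : IsCompact (Metric.closedBall (0 : F) (2 * Real.pi)) := isCompact_closedBall _ _
  have := hK.eventually_forall_of_forall_eventually (x₀ := u)
    (P := fun v k => IsLog Φ u k → ∃ k₁ ∈ commSpan (v - 1), ‖k - k₁‖ < η) fun k _ => by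
      by_cases hk : IsLog Φ u k
      · obtain ⟨c, m, hcm⟩ := hk.exists_eq_sum
        let f : F → F := fun v => ∑ r, c r • selfComm ((v - 1) * m r * star (v - 1))
        have hf : Continuous f := by
          refine continuous_finsetSum _ fun r _ => Continuous.const_smul
            (continuous_selfComm.comp ?_) _
          have : Continuous fun v : F => v - 1 := continuous_id.sub continuous_const
          exact (this.mul continuous_const).mul this.star
        have : ∀ᶠ z : F × F in 𝓝 (u, k), ‖z.2 - f z.1‖ < η := by
          refine (continuous_snd.sub (hf.comp continuous_fst)).norm.continuousAt.eventually_lt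
            continuousAt_const ?_
          have hfk : f u = k := hcm.symm
          change ‖k - f u‖ < η
          rwa [hfk, sub_self, norm_zero]
        filter_upwards [this] with z hz _
        exact ⟨f z.1, Submodule.sum_mem _ fun r _ => Submodule.smul_mem _ _
          (Submodule.subset_span ⟨m r, rfl⟩), hz⟩
      · have hcl : IsClosed {k | IsLog Φ u k} :=
          (isClosed_isLog Φ).preimage (Continuous.prodMk_right u)
        have hev : ∀ᶠ x in 𝓝 k, ¬ IsLog Φ u x :=
          hcl.isOpen_compl.mem_nhds (show k ∈ {k | IsLog Φ u k}ᶜ from hk)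
        filter_upwards [(continuous_snd (X := F)).continuousAt.eventually hev] with z hz hz'
        exact absurd hz' hz
  filter_upwards [this] with v hv h hh
  exact hv h (by simpa using hh.norm_le) hh

end Local

end CUPath

namespace CUPath

open Topology Filter

section Hereditary

variable {E : Type*} [NonUnitalCStarAlgebra E]

/-- The C⋆-subalgebra `closure (e B e)` generated by a self-adjoint element `e` of `B`. -/
def herSub (B : NonUnitalStarSubalgebra ℂ E) (e : E) (he : e ∈ B) (hes : IsSelfAdjoint e) :
    NonUnitalStarSubalgebra ℂ E :=
  NonUnitalStarSubalgebra.topologicalClosure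
    { carrier := {x | ∃ b ∈ B, x = e * b * e}
      zero_mem' := ⟨0, zero_mem B, by simp⟩
      add_mem' := by
        rintro _ _ ⟨b, hb, rfl⟩ ⟨c, hc, rfl⟩
        exact ⟨b + c, add_mem hb hc, by rw [mul_add, add_mul]⟩
      mul_mem' := by
        rintro _ _ ⟨b, hb, rfl⟩ ⟨c, hc, rfl⟩
        exact ⟨b * e * e * c, mul_mem (mul_mem (mul_mem hb he) he) hc, by simp only [mul_assoc]⟩
      smul_mem' := by
        rintro r _ ⟨b, hb, rfl⟩
        exact ⟨r • b, SMulMemClass.smul_mem r hb, by rw [mul_smul_comm, smul_mul_assoc]⟩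
      star_mem' := by
        rintro _ ⟨b, hb, rfl⟩
        exact ⟨star b, star_mem hb, by simp [hes.star_eq, mul_assoc]⟩ }

lemma mul_mul_mem_herSub {B : NonUnitalStarSubalgebra ℂ E} {e : E} {he : e ∈ B}
    {hes : IsSelfAdjoint e} {b : E} (hb : b ∈ B) : e * b * e ∈ herSub B e he hes :=
  subset_closure ⟨b, hb, rfl⟩

lemma map_mem_range_of_mem_herSub {B : NonUnitalStarSubalgebra ℂ E} {e : E} {he : e ∈ B}
    {hes : IsSelfAdjoint e} {F : Type*} [CStarAlgebra F] [FiniteDimensional ℂ F]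
    (f : E →⋆ₙₐ[ℂ] F) (hf : Continuous f) {x : E} (hx : x ∈ herSub B e he hes) :
    ∃ m, f x = f e * m * f e := by
  let L : F →ₗ[ℂ] F := (LinearMap.mulRight ℂ (f e)).comp (LinearMap.mulLeft ℂ (f e))
  have hcl : IsClosed (LinearMap.range L : Set F) := Submodule.closed_of_finiteDimensional _
  have : x ∈ f ⁻¹' (LinearMap.range L : Set F) := by
    refine closure_minimal ?_ (hcl.preimage hf) hx
    rintro _ ⟨b, -, rfl⟩
    exact ⟨f b, by simp [L]⟩
  obtain ⟨m, hm⟩ := this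
  exact ⟨m, by rw [← hm]; simp [L]⟩

end Hereditary

section CU

variable {E : Type*} [NonUnitalCStarAlgebra E] (A : NonUnitalStarSubalgebra ℂ E)

/-- The unitization of `A`, inside the unitization of the ambient algebra. -/
def unitizationSub : Subalgebra ℂ (Unitization ℂ E) where
  carrier := {v | v.snd ∈ A}
  mul_mem' := by
    intro v w hv hw
    simp only [Set.mem_ofPred_eq, Unitization.snd_mul] at *
    exact add_mem (add_mem (SMulMemClass.smul_mem _ hw) (SMulMemClass.smul_mem _ hv)) (mul_mem hv hw)
  add_mem' := fun hv hw => by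
    simp only [Set.mem_ofPred_eq, Unitization.snd_add] at *
    exact add_mem hv hw
  algebraMap_mem' := fun r => by
    simp [Unitization.algebraMap_eq_inl]

lemma isClosed_unitizationSub (hA : IsClosed (A : Set E)) :
    IsClosed (unitizationSub A : Set (Unitization ℂ E)) :=
  hA.preimage Unitization.continuous_snd

lemma one_mem_unitizationUnitary : (1 : Unitization ℂ E) ∈ unitizationUnitary (A : Set E) :=
  ⟨one_mem _, (one_mem (unitizationSub A) : _)⟩

variable {A}

lemma mul_mem_unitizationUnitary {v w : Unitization ℂ E}
    (hv : v ∈ unitizationUnitary (A : Set E)) (hw : w ∈ unitizationUnitary (A : Set E)) :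
    v * w ∈ unitizationUnitary (A : Set E) :=
  ⟨mul_mem hv.1 hw.1, (mul_mem (S := Subalgebra ℂ (Unitization ℂ E))
    (s := unitizationSub A) hv.2 hw.2 : _)⟩

lemma star_mem_unitizationUnitary {v : Unitization ℂ E}
    (hv : v ∈ unitizationUnitary (A : Set E)) : star v ∈ unitizationUnitary (A : Set E) :=
  ⟨Unitary.star_mem hv.1, by simpa using star_mem (s := A) hv.2⟩

lemma isClosed_unitizationUnitary (hA : IsClosed (A : Set E)) :
    IsClosed (unitizationUnitary (A : Set E)) := by
  refine IsClosed.inter ?_ (isClosed_unitizationSub A hA)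
  have : (unitary (Unitization ℂ E) : Set (Unitization ℂ E)) =
      {v | star v * v = 1} ∩ {v | v * star v = 1} := by
    ext v
    simp [Unitary.mem_iff]
  change IsClosed (unitary (Unitization ℂ E) : Set (Unitization ℂ E))
  rw [this]
  exact (isClosed_eq (continuous_star.mul continuous_id) continuous_const).inter
    (isClosed_eq (continuous_id.mul continuous_star) continuous_const)

lemma uexp_inr_mem (hA : IsClosed (A : Set E)) {a : E} (ha : a ∈ A) (has : IsSelfAdjoint a) :
    uexp (a : Unitization ℂ E) ∈ unitizationUnitary (A : Set E) := by
  let _ : Algebra ℚ (Unitization ℂ E) := .restrictScalars ℚ ℂ (Unitization ℂ E)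
  have hu : IsSelfAdjoint (a : Unitization ℂ E) := by
    rw [IsSelfAdjoint, ← Unitization.inr_star, has.star_eq]
  refine ⟨uexp_mem_unitary hu, ?_⟩
  refine NormedSpace.exp_mem (s := unitizationSub A) (isClosed_unitizationSub A hA) ?_
  exact Subalgebra.smul_mem _ (show (a : Unitization ℂ E).snd ∈ A by simpa using ha) _

variable (A)

/-- `CU(Ã)` as a submonoid of the unitization of the ambient algebra. -/
def cuSubmonoid : Submonoid (Unitization ℂ E) :=
  Submonoid.topologicalClosure
    { carrier := {z | ∃ l : List (Unitization ℂ E),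
        (∀ v ∈ l, ∃ a ∈ unitizationUnitary (A : Set E), ∃ b ∈ unitizationUnitary (A : Set E),
          v = a * b * star a * star b) ∧ z = l.prod}
      one_mem' := ⟨[], by simp, by simp⟩
      mul_mem' := by
        rintro _ _ ⟨l, hl, rfl⟩ ⟨m, hm, rfl⟩
        refine ⟨l ++ m, fun v hv => ?_, by simp⟩
        rcases List.mem_append.1 hv with h | h
        exacts [hl v h, hm v h] }

lemma isClosed_cuSubmonoid : IsClosed (cuSubmonoid A : Set (Unitization ℂ E)) := isClosed_closure

variable {A}

lemma commutator_mem_cuSubmonoid {a b : Unitization ℂ E}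
    (ha : a ∈ unitizationUnitary (A : Set E)) (hb : b ∈ unitizationUnitary (A : Set E)) :
    a * b * star a * star b ∈ cuSubmonoid A :=
  subset_closure ⟨[a * b * star a * star b], by
    rintro v hv
    rw [List.mem_singleton] at hv
    exact ⟨a, ha, b, hb, hv⟩, by simp⟩

lemma cuSubmonoid_induction {p : Unitization ℂ E → Prop} (hp : IsClosed {z | p z}) (h1 : p 1)
    (hmul : ∀ v w, p v → p w → p (v * w))
    (hc : ∀ a ∈ unitizationUnitary (A : Set E), ∀ b ∈ unitizationUnitary (A : Set E),
      p (a * b * star a * star b)) {z : Unitization ℂ E} (hz : z ∈ cuSubmonoid A) : p z := by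
  refine closure_minimal (t := {z | p z}) ?_ hp hz
  rintro _ ⟨l, hl, rfl⟩
  induction l with
  | nil => simpa using h1
  | cons v l ih =>
    rw [List.prod_cons]
    obtain ⟨a, ha, b, hb, rfl⟩ := hl v (by simp)
    exact hmul _ _ (hc a ha b hb) (ih fun w hw => hl w (by simp [hw]))

lemma mem_unitizationUnitary_of_mem_cuSubmonoid (hA : IsClosed (A : Set E))
    {z : Unitization ℂ E} (hz : z ∈ cuSubmonoid A) : z ∈ unitizationUnitary (A : Set E) :=
  cuSubmonoid_induction (p := fun z => z ∈ unitizationUnitary (A : Set E))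
    (isClosed_unitizationUnitary hA) (one_mem_unitizationUnitary A)
    (fun _ _ => mul_mem_unitizationUnitary) (fun _ ha _ hb =>
      mul_mem_unitizationUnitary (mul_mem_unitizationUnitary (mul_mem_unitizationUnitary ha hb)
        (star_mem_unitizationUnitary ha)) (star_mem_unitizationUnitary hb)) hz

lemma map_eq_one_of_mem_cuSubmonoid {M : Type*} [CommMonoid M] [TopologicalSpace M] [T1Space M]
    (χ : Unitization ℂ E →* M) (hχ : Continuous χ) {z : Unitization ℂ E}
    (hz : z ∈ cuSubmonoid A) : χ z = 1 := by
  refine cuSubmonoid_induction (p := fun z => χ z = 1)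
    (isClosed_singleton.preimage hχ) (map_one χ) (fun v w hv hw => by simp [hv, hw])
    (fun a ha b hb => ?_) hz
  calc χ (a * b * star a * star b) = χ (a * star a) * χ (b * star b) := by
        simp only [map_mul]
        rw [mul_right_comm (χ a), mul_assoc (χ a * χ (star a))]
    _ = 1 := by
      rw [Unitary.mul_star_self_of_mem ha.1, Unitary.mul_star_self_of_mem hb.1, map_one, mul_one]

lemma fst_eq_one_of_mem_cuSubmonoid {z : Unitization ℂ E} (hz : z ∈ cuSubmonoid A) :
    z.fst = 1 :=
  map_eq_one_of_mem_cuSubmonoid (Unitization.fstHom ℂ E : Unitization ℂ E →* ℂ)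
    Unitization.continuous_fst hz

lemma inr_selfComm_mem_expSubspace (hA : IsClosed (A : Set E)) {x : E} (hx : x ∈ A) :
    ((selfComm x : E) : Unitization ℂ E) ∈
      expSubspace (cuSubmonoid A) (isClosed_cuSubmonoid A) := by
  set a : E := (2⁻¹ : ℂ) • (x + star x) with ha
  set b : E := (-(Complex.I * 2⁻¹) : ℂ) • (x - star x) with hb
  have haA : a ∈ A := SMulMemClass.smul_mem _ (add_mem hx (star_mem hx))
  have hbA : b ∈ A := SMulMemClass.smul_mem _ (sub_mem hx (star_mem hx))
  have has : IsSelfAdjoint a := by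
    rw [IsSelfAdjoint, ha, star_smul, star_add, star_star, add_comm]
    simp
  have hbs : IsSelfAdjoint b := by
    rw [IsSelfAdjoint, hb, star_smul, star_sub, star_star, ← neg_sub x, smul_neg, ← neg_smul]
    simp
  have hinr : ∀ {c : E}, IsSelfAdjoint c → IsSelfAdjoint (c : Unitization ℂ E) := fun {c} hc => by
    rw [IsSelfAdjoint, ← Unitization.inr_star, hc.star_eq]
  have hu : ∀ {c : E}, c ∈ A → IsSelfAdjoint c → ∀ r : ℝ,
      uexp (r • (c : Unitization ℂ E)) ∈ unitizationUnitary (A : Set E) := fun {c} hc hcs r => by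
    rw [← Unitization.inr_smul]
    refine uexp_inr_mem hA ?_ (by rw [IsSelfAdjoint, star_smul, hcs.star_eq, star_trivial])
    have := SMulMemClass.smul_mem (r : ℂ) hc
    rwa [Complex.coe_smul] at this
  have key := I_smul_commutator_mem_expSubspace (isClosed_cuSubmonoid A) (hinr has) (hinr hbs)
    (fun r s => commutator_mem_cuSubmonoid (hu haA has r) (hu hbA hbs s))
  have e : selfComm x = (-2 : ℝ) • (Complex.I • (a * b - b * a)) := by
    have h : a * b - b * a = (-(Complex.I * 4⁻¹) : ℂ) • ((-2 : ℂ) • selfComm x) := by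
      rw [ha, hb, selfComm]
      simp only [smul_mul_smul_comm, mul_add, add_mul, mul_sub, sub_mul]
      module
    rw [h, ← Complex.coe_smul, smul_smul, smul_smul, smul_smul]
    have : ((-2 : ℝ) : ℂ) * Complex.I * -(Complex.I * 4⁻¹) * -2 = 1 := by
      push_cast
      linear_combination (-1 : ℂ) * Complex.I_mul_I
    rw [this, one_smul]
  rw [e, Unitization.inr_smul, Unitization.inr_smul, Unitization.inr_sub, Unitization.inr_mul,
    Unitization.inr_mul]
  exact Submodule.smul_mem _ _ key

end CU

end CUPath

namespace CUPath

open Topology Filter unitInterval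
open scoped CStarAlgebra

section Block

variable {F₁ F₂ : Type*} [CStarAlgebra F₁] [CStarAlgebra F₂] (φ₀ φ₁ : F₁ →⋆ₙₐ[ℂ] F₂)

/-- The Elliott–Thomsen building block as a C⋆-subalgebra of `C([0,1], F₂) × F₁`. -/
def etSub : NonUnitalStarSubalgebra ℂ (C(I, F₂) × F₁) where
  carrier := ETBlock φ₀ φ₁
  zero_mem' := by simp [ETBlock]
  add_mem' := by
    rintro a b ⟨ha, ha'⟩ ⟨hb, hb'⟩
    simp [ETBlock, *]
  mul_mem' := by
    rintro a b ⟨ha, ha'⟩ ⟨hb, hb'⟩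
    simp [ETBlock, *]
  smul_mem' := by
    rintro c a ⟨ha, ha'⟩
    simp [ETBlock, *]
  star_mem' := by
    rintro a ⟨ha, ha'⟩
    simp [ETBlock, map_star, *]

variable {φ₀ φ₁}

lemma mem_etSub {x : C(I, F₂) × F₁} : x ∈ etSub φ₀ φ₁ ↔ x.1 0 = φ₀ x.2 ∧ x.1 1 = φ₁ x.2 :=
  Iff.rfl

lemma isSelfAdjoint_selfComm {A : Type*} [NonUnitalRing A] [StarRing A] (x : A) :
    IsSelfAdjoint (selfComm x) := by
  simp [IsSelfAdjoint, selfComm]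

variable (φ₀ φ₁)

/-- The real span of the self-commutators of elements of `e B e`, for `B` an Elliott–Thomsen
building block. -/
def corSpan (e : C(I, F₂) × F₁) : Submodule ℝ (C(I, F₂) × F₁) :=
  Submodule.span ℝ ((fun b => selfComm (e * b * e)) '' (etSub φ₀ φ₁ : Set (C(I, F₂) × F₁)))

variable {φ₀ φ₁} {e : C(I, F₂) × F₁}

lemma selfComm_mem_corSpan {b : C(I, F₂) × F₁} (hb : b ∈ etSub φ₀ φ₁) :
    selfComm (e * b * e) ∈ corSpan φ₀ φ₁ e :=
  Submodule.subset_span ⟨b, hb, rfl⟩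

lemma mem_etSub_of_mem_corSpan (he : e ∈ etSub φ₀ φ₁) {K : C(I, F₂) × F₁}
    (hK : K ∈ corSpan φ₀ φ₁ e) : K ∈ etSub φ₀ φ₁ := by
  induction hK using Submodule.span_induction with
  | mem x hx =>
    obtain ⟨b, hb, rfl⟩ := hx
    have : e * b * e ∈ etSub φ₀ φ₁ := mul_mem (mul_mem he hb) he
    exact sub_mem (mul_mem this (star_mem this)) (mul_mem (star_mem this) this)
  | zero => exact zero_mem _
  | add x y _ _ hx hy => exact add_mem hx hy
  | smul c x _ hx =>
    have := SMulMemClass.smul_mem (s := etSub φ₀ φ₁) (c : ℂ) hx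
    rwa [Complex.coe_smul] at this

lemma isSelfAdjoint_of_mem_corSpan {K : C(I, F₂) × F₁}
    (hK : K ∈ corSpan φ₀ φ₁ e) : IsSelfAdjoint K := by
  induction hK using Submodule.span_induction with
  | mem x hx =>
    obtain ⟨b, hb, rfl⟩ := hx
    exact isSelfAdjoint_selfComm _
  | zero => exact .zero _
  | add x y _ _ hx hy => exact hx.add hy
  | smul c x _ hx => rw [IsSelfAdjoint, star_smul, hx.star_eq, star_trivial]

lemma smul_mem_corSpan {K : C(I, F₂) × F₁} (hK : K ∈ corSpan φ₀ φ₁ e) {ρ : C(I, ℝ)}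
    (hρ : ∀ t, 0 ≤ ρ t) {c : ℝ} (h0 : ρ 0 = c) (h1 : ρ 1 = c) :
    ((ρ • K.1, c • K.2) : C(I, F₂) × F₁) ∈ corSpan φ₀ φ₁ e := by
  have hc : 0 ≤ c := h0 ▸ hρ 0
  have hsq : ∀ t, Real.sqrt (ρ t) * Real.sqrt (ρ t) = ρ t := fun t => Real.mul_self_sqrt (hρ t)
  induction hK using Submodule.span_induction with
  | mem x hx =>
    obtain ⟨b, hb, rfl⟩ := hx
    let q : C(I, ℝ) := ⟨fun t => Real.sqrt (ρ t), by fun_prop⟩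
    let b' : C(I, F₂) × F₁ := (q • b.1, Real.sqrt c • b.2)
    have hb' : b' ∈ etSub φ₀ φ₁ := by
      obtain ⟨h, h'⟩ := hb
      have hm : ∀ (f : F₁ →⋆ₙₐ[ℂ] F₂) (r : ℝ) (x : F₁), f (r • x) = r • f x := fun f r x => by
        rw [← Complex.coe_smul, map_smul, Complex.coe_smul]
      refine ⟨?_, ?_⟩
      · simp [b', q, hm, h, h0]
      · simp [b', q, hm, h', h1]
    convert selfComm_mem_corSpan (e := e) hb' using 1
    refine Prod.ext ?_ ?_
    · ext t
      simp [selfComm, b', q, smul_smul, hsq, smul_sub]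
    · simp [selfComm, b', smul_smul, Real.mul_self_sqrt hc, smul_sub]
  | zero =>
    convert zero_mem (corSpan φ₀ φ₁ e) using 1
    refine Prod.ext ?_ (by simp)
    ext t
    simp
  | add x y _ _ hx hy =>
    convert add_mem hx hy using 1
    refine Prod.ext ?_ (by simp)
    ext t
    simp
  | smul r x _ hx =>
    convert Submodule.smul_mem _ r hx using 1
    refine Prod.ext ?_ (by simp [smul_comm r])
    ext t
    simp [smul_comm r]

lemma exists_mem_corSpan_eval_eq (he : IsSelfAdjoint e) {t₀ : I} (h0 : t₀ ≠ 0) (h1 : t₀ ≠ 1) {k : F₂}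
    (hk : k ∈ commSpan (e.1 t₀)) :
    ∃ K ∈ corSpan φ₀ φ₁ e, K.2 = 0 ∧ K.1 t₀ = k := by
  have hes : star (e.1 t₀) = e.1 t₀ := congrArg (fun x : C(I, F₂) × F₁ => x.1 t₀) he
  induction hk using Submodule.span_induction with
  | mem x hx =>
    obtain ⟨m, rfl⟩ := hx
    have hne : (t₀ : ℝ) * (1 - t₀) ≠ 0 := by
      refine mul_ne_zero (fun h => h0 (Subtype.ext h)) fun h => h1 (Subtype.ext ?_)
      simpa using (sub_eq_zero.1 h).symm
    let f : C(I, F₂) := ⟨fun t => (((t : ℝ) * (1 - t)) / ((t₀ : ℝ) * (1 - t₀))) • m, by fun_prop⟩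
    refine ⟨selfComm (e * (f, 0) * e), selfComm_mem_corSpan ?_, by simp [selfComm], ?_⟩
    · simp [mem_etSub, f]
    · have : f t₀ = m := by
        simp [f, div_self hne]
      simp [selfComm, this, hes]
  | zero => exact ⟨0, zero_mem _, by simp⟩
  | add x y _ _ hx hy =>
    obtain ⟨K, hK, hK', rfl⟩ := hx
    obtain ⟨L, hL, hL', rfl⟩ := hy
    exact ⟨K + L, add_mem hK hL, by simp [hK', hL']⟩
  | smul r x _ hx =>
    obtain ⟨K, hK, hK', rfl⟩ := hx
    exact ⟨r • K, Submodule.smul_mem _ r hK, by simp [hK']⟩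

lemma exists_mem_corSpan_snd_eq (he : IsSelfAdjoint e) {k : F₁} (hk : k ∈ commSpan e.2) :
    ∃ K ∈ corSpan φ₀ φ₁ e, K.2 = k := by
  have hes : star e.2 = e.2 := congrArg Prod.snd he
  induction hk using Submodule.span_induction with
  | mem x hx =>
    obtain ⟨m, rfl⟩ := hx
    let f : C(I, F₂) := ⟨fun t => (1 - (t : ℝ)) • φ₀ m + (t : ℝ) • φ₁ m, by fun_prop⟩
    refine ⟨selfComm (e * (f, m) * e), selfComm_mem_corSpan ?_, by simp [selfComm, hes]⟩
    simp [mem_etSub, f]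
  | zero => exact ⟨0, zero_mem _, by simp⟩
  | add x y _ _ hx hy =>
    obtain ⟨K, hK, rfl⟩ := hx
    obtain ⟨L, hL, rfl⟩ := hy
    exact ⟨K + L, add_mem hK hL, by simp⟩
  | smul r x _ hx =>
    obtain ⟨K, hK, rfl⟩ := hx
    exact ⟨r • K, Submodule.smul_mem _ r hK, by simp⟩

lemma exists_mem_corSpan_near (he : IsSelfAdjoint e) {h : C(I, F₂)} (h0 : h 0 = 0) (h1 : h 1 = 0)
    {η : ℝ} (hη : 0 < η) (hloc : ∀ t, ∃ k ∈ commSpan (e.1 t), ‖k - h t‖ < η) :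
    ∃ K ∈ corSpan φ₀ φ₁ e, K.2 = 0 ∧ ∀ t, ‖K.1 t - h t‖ < η := by
  have hpt : ∀ t₀ : I, ∃ K ∈ corSpan φ₀ φ₁ e, K.2 = 0 ∧ ∃ U : Set I, IsOpen U ∧ t₀ ∈ U ∧
      (∀ t ∈ U, ‖K.1 t - h t‖ < η) ∧ (K = 0 ∨ (0 ∉ U ∧ 1 ∉ U)) := by
    intro t₀
    have hopen : ∀ K : C(I, F₂) × F₁, IsOpen {t | ‖K.1 t - h t‖ < η} := fun K =>
      isOpen_lt (by fun_prop) continuous_const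
    by_cases ht : t₀ = 0 ∨ t₀ = 1
    · refine ⟨0, zero_mem _, rfl, _, hopen 0, ?_, fun t ht => ht, Or.inl rfl⟩
      rcases ht with rfl | rfl
      · simpa [h0] using hη
      · simpa [h1] using hη
    · push Not at ht
      obtain ⟨k, hk, hkn⟩ := hloc t₀
      obtain ⟨K, hK, hK2, rfl⟩ := exists_mem_corSpan_eval_eq (φ₀ := φ₀) (φ₁ := φ₁) he ht.1 ht.2 hk
      refine ⟨K, hK, hK2, {t | ‖K.1 t - h t‖ < η} ∩ ({0, 1} : Set I)ᶜ, (hopen K).inter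
        (Set.toFinite _).isClosed.isOpen_compl, ⟨hkn, by simpa using ht⟩, fun t ht => ht.1,
        Or.inr ⟨by simp, by simp⟩⟩
  choose K hK hK2 U hUo hmem hU hK01 using hpt
  obtain ⟨s, hs⟩ := isCompact_univ.elim_nhds_subcover U fun t _ => (hUo t).mem_nhds (hmem t)
  obtain ⟨f, hf⟩ := PartitionOfUnity.exists_isSubordinate (isClosed_univ (X := I))
    (fun i : s => U i) (fun i => hUo i) (by simpa [Set.iUnion_subtype] using hs.2)
  have hsupp : ∀ (i : s) (t : I), t ∉ U i → f i t = 0 := fun i t ht => by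
    by_contra hne
    exact ht (hf i (subset_tsupport _ hne))
  refine ⟨∑ i : s, ((f i • (K i).1, 0) : C(I, F₂) × F₁), Submodule.sum_mem _ fun i _ => ?_, ?_, ?_⟩
  · rcases hK01 i with hz | ⟨hz, hz'⟩
    · rw [hz]
      convert zero_mem (corSpan φ₀ φ₁ e) using 1
      refine Prod.ext ?_ rfl
      ext t
      simp
    · simpa using smul_mem_corSpan (hK i) (ρ := f i) (fun t => f.nonneg i t)
        (hsupp i 0 hz) (hsupp i 1 hz')
  · simp [Prod.snd_sum]
  · intro t
    have : (∑ i : s, ((f i • (K i).1, 0) : C(I, F₂) × F₁)).1 t = ∑ i, f i t • (K i).1 t := by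
      simp [Prod.fst_sum]
    rw [this, ← mem_ball_iff_norm, ← finsum_eq_sum_of_fintype]
    refine (convex_ball (h t) η).finsum_mem (fun i => f.nonneg i t) (f.sum_eq_one (Set.mem_univ t))
      fun i hi => mem_ball_iff_norm.2 (hU i t ?_)
    by_contra hne
    exact hi (hsupp i t hne)

end Block

end CUPath

namespace CUPath

open Topology Filter unitInterval
open scoped CStarAlgebra

section ApproxLog

variable {F : Type*} [CStarAlgebra F] {n : ℕ} {d : Fin n → ℕ}
  (Φ : F ≃⋆ₐ[ℂ] ((i : Fin n) → Matrix (Fin (d i)) (Fin (d i)) ℂ))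

/-- `x` is within `η` of the real span of the self-commutators attached to `u - 1`, and of a
self-adjoint element of norm at most `2π` whose exponential is within `δ` of `u`. -/
structure IsApproxLog (η δ : ℝ) (u x : F) : Prop where
  exists_near_commSpan : ∃ k ∈ commSpan (u - 1), ‖k - x‖ < η
  exists_near_log : ∃ k, ‖k‖ ≤ 2 * Real.pi ∧ ‖x - k‖ < η ∧ ‖uexp k - u‖ < δ

lemma IsLog.joinedIn_thickening [FiniteDimensional ℂ F] {u h h' k k' : F} {η : ℝ}
    (hk : IsLog Φ u k) (hk' : IsLog Φ u k') (hη : ‖h - k‖ < η) (hη' : ‖h' - k'‖ < η) :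
    JoinedIn {x | ∃ k, IsLog Φ u k ∧ ‖x - k‖ < η} h h' := by
  have aux : ∀ {h k : F}, IsLog Φ u k → ‖h - k‖ < η →
      JoinedIn {x | ∃ k, IsLog Φ u k ∧ ‖x - k‖ < η} h k := fun {h k} hk hη => by
    refine JoinedIn.of_segment_subset fun x hx => ⟨k, hk, ?_⟩
    have hb : segment ℝ h k ⊆ Metric.ball k η :=
      (convex_ball k η).segment_subset (mem_ball_iff_norm.2 hη)
        (Metric.mem_ball_self ((norm_nonneg _).trans_lt hη))
    exact mem_ball_iff_norm.1 (hb hx)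
  refine (aux hk hη).trans (JoinedIn.trans ?_ (aux hk' hη').symm)
  refine (hk.joinedIn hk').mono fun x hx => ⟨x, hx, ?_⟩
  simpa using (norm_nonneg _).trans_lt hη

lemma exists_isApproxLog_nhds [FiniteDimensional ℂ F] {U : ℝ → F} (hU : Continuous U) {η δ : ℝ}
    (hη : 0 < η) (hδ : 0 < δ) (τ : ℝ) :
    ∀ᶠ s in 𝓝 τ, (∀ h, IsLog Φ (U s) h → ∃ k, IsLog Φ (U τ) k ∧ ‖h - k‖ < η / 2) ∧
      ∀ x, (∃ k, IsLog Φ (U τ) k ∧ ‖x - k‖ < η / 2) → IsApproxLog η δ (U s) x := by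
  have h1 := hU.continuousAt.eventually (eventually_isLog_near Φ (U τ) (half_pos hη))
  have h2 := hU.continuousAt.eventually (eventually_near_commSpan Φ (U τ) (half_pos hη))
  have h3 := hU.continuousAt.eventually (Metric.ball_mem_nhds (U τ) hδ)
  filter_upwards [h1, h2, h3] with s hs1 hs2 hs3
  refine ⟨hs1, ?_⟩
  rintro x ⟨k, hk, hx⟩
  obtain ⟨k₁, hk₁, hkk⟩ := hs2 k hk
  refine ⟨⟨k₁, hk₁, ?_⟩, k, hk.norm_le, by linarith, ?_⟩
  · calc ‖k₁ - x‖ = ‖(x - k) + (k - k₁)‖ := by rw [norm_sub_rev]; congr 1; abel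
      _ ≤ ‖x - k‖ + ‖k - k₁‖ := norm_add_le _ _
      _ < η := by linarith
  · rw [hk.uexp_eq, ← mem_ball_iff_norm']
    exact hs3

lemma exists_isApproxLog_path [FiniteDimensional ℂ F] {U : ℝ → F} (hU : Continuous U)
    (hlog : ∀ t, ∃ h, IsLog Φ (U t) h) (hU0 : U 0 = 1) (hU1 : U 1 = 1) {η δ : ℝ}
    (hη : 0 < η) (hδ : 0 < δ) :
    ∃ h : ℝ → F, Continuous h ∧ h 0 = 0 ∧ h 1 = 0 ∧
      ∀ t ∈ Set.Icc (0 : ℝ) 1, IsApproxLog η δ (U t) (h t) := by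
  choose H hH using hlog
  have hloc := fun τ => exists_isApproxLog_nhds Φ hU hη hδ τ
  simp only [eventually_nhds_iff] at hloc
  choose W hW hWo hWm using hloc
  obtain ⟨t, ht0, htm, ⟨m, hm⟩, htW⟩ := exists_monotone_Icc_subset_open_cover_unitInterval
    (c := fun τ : ℝ => ((↑) : I → ℝ) ⁻¹' W τ) (fun τ => (hWo τ).preimage continuous_subtype_val)
    (fun s _ => Set.mem_iUnion.2 ⟨s, hWm s⟩)
  have step : ∀ j : ℕ, ∃ h : ℝ → F, Continuous h ∧ h (t j) = H (t j) ∧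
      h (t (j + 1)) = H (t (j + 1)) ∧
      ∀ s ∈ Set.Icc (t j : ℝ) (t (j + 1)), IsApproxLog η δ (U s) (h s) := by
    intro j
    obtain ⟨τ, hτ⟩ := htW j
    have hsub : ∀ s ∈ Set.Icc (t j : ℝ) (t (j + 1)), s ∈ W τ := fun s hs =>
      hτ (show (⟨s, (t j).2.1.trans hs.1, hs.2.trans (t (j + 1)).2.2⟩ : I) ∈ _ from
        ⟨hs.1, hs.2⟩)
    have hle : (t j : ℝ) ≤ t (j + 1) := htm (Nat.le_succ j)
    obtain ⟨k, hk, hkn⟩ := (hW τ _ (hsub _ (Set.left_mem_Icc.2 hle))).1 _ (hH _)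
    obtain ⟨k', hk', hkn'⟩ := (hW τ _ (hsub _ (Set.right_mem_Icc.2 hle))).1 _ (hH _)
    rcases hle.eq_or_lt with heq | hlt
    · refine ⟨fun _ => H (t j), continuous_const, rfl, by rw [heq], fun s hs => ?_⟩
      exact (hW τ s (hsub s hs)).2 _ ⟨k, hk, hkn⟩
    · obtain ⟨γ, hγ⟩ := hk.joinedIn_thickening Φ hk' hkn hkn'
      refine ⟨fun s => γ.extend ((s - t j) / (t (j + 1) - t j)), ?_, ?_, ?_, fun s hs => ?_⟩
      · exact γ.continuous_extend.comp ((continuous_id.sub continuous_const).div_const _)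
      · simp
      · simp [div_self (sub_pos.2 hlt).ne']
      · refine (hW τ s (hsub s hs)).2 _ ?_
        have : γ.extend ((s - t j) / (t (j + 1) - t j)) ∈ Set.range γ := by
          rw [← Path.extend_range]
          exact ⟨_, rfl⟩
        obtain ⟨r, hr⟩ := this
        have := hγ r
        rwa [hr] at this
  have main : ∀ j : ℕ, ∃ h : ℝ → F, Continuous h ∧ h 0 = H 0 ∧ h (t j) = H (t j) ∧
      ∀ s ∈ Set.Icc (0 : ℝ) (t j), IsApproxLog η δ (U s) (h s) := by
    intro j
    induction j with
    | zero =>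
      refine ⟨fun _ => H 0, continuous_const, rfl, by simp [ht0], fun s hs => ?_⟩
      have hs0 : s = 0 := by simpa [ht0] using hs
      obtain ⟨k, hk, hkn⟩ := (hW 0 0 (hWm 0)).1 _ (hH _)
      rw [hs0]
      exact (hW 0 0 (hWm 0)).2 _ ⟨k, hk, hkn⟩
    | succ j ih =>
      obtain ⟨h, hc, h0, hj, hs⟩ := ih
      obtain ⟨g, gc, g0, gj, gs⟩ := step j
      have hle : (t j : ℝ) ≤ t (j + 1) := htm (Nat.le_succ j)
      refine ⟨fun s => if s ≤ t j then h s else g s, ?_, ?_, ?_, fun s hs' => ?_⟩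
      · refine hc.if_le gc continuous_id continuous_const fun s hs => ?_
        have hs : s = t j := hs
        rw [hs, hj, g0]
      · simp [h0, (t j).2.1]
      · rcases hle.eq_or_lt with heq | hlt
        · simp [← heq, hj]
        · simp [hlt.not_ge, gj]
      · by_cases hst : s ≤ t j
        · simpa [hst] using hs s ⟨hs'.1, hst⟩
        · simpa [hst] using gs s ⟨(not_le.1 hst).le, hs'.2⟩
  obtain ⟨h, hc, h0, h1, hs⟩ := main m
  have htm1 : (t m : ℝ) = 1 := by rw [hm m le_rfl]; rfl
  rw [htm1] at h1 hs
  refine ⟨h, hc, ?_, ?_, hs⟩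
  · rw [h0]
    exact IsLog.eq_zero (hU0 ▸ hH 0)
  · rw [h1]
    exact IsLog.eq_zero (hU1 ▸ hH 1)

end ApproxLog

end CUPath

namespace CUPath

open Topology Filter unitInterval
open scoped CStarAlgebra

section SmallLog

variable {F : Type*} [CStarAlgebra F] {n : ℕ} {d : Fin n → ℕ}
  (Φ : F ≃⋆ₐ[ℂ] ((i : Fin n) → Matrix (Fin (d i)) (Fin (d i)) ℂ))

lemma norm_diagHom (V : unitary F) (θ : (i : Fin n) → Fin (d i) → ℂ) :
    ‖diagHom Φ V θ‖ = ‖θ‖ := by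
  refine NonUnitalStarAlgHom.norm_map (diagHom Φ V) (fun a b hab => ?_) θ
  funext i
  have := star_mul_diagHom_mul Φ V a i
  rw [hab, star_mul_diagHom_mul] at this
  exact (Matrix.diagonal_injective this).symm

lemma isLog_of_norm_lt {h : F} (hh : IsSelfAdjoint h) (hπ : ‖h‖ ≤ Real.pi)
    (hd : ∀ i, d i * ‖h‖ < 2 * Real.pi) (hdet : ∀ i, (Φ (uexp h) i).det = 1) :
    IsLog Φ (uexp h) h := by
  obtain ⟨V, θ, rfl⟩ := exists_eq_diagHom Φ hh
  have hθ : ∀ i k, |θ i k| ≤ ‖diagHom Φ V fun i k => (θ i k : ℂ)‖ := fun i k => by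
    rw [norm_diagHom]
    calc |θ i k| = ‖(θ i k : ℂ)‖ := by simp
      _ ≤ ‖fun k => (θ i k : ℂ)‖ := norm_le_pi_norm (fun k => (θ i k : ℂ)) k
      _ ≤ _ := norm_le_pi_norm (fun i k => (θ i k : ℂ)) i
  refine isLog_diagHom Φ V (fun i => ?_) fun i k l => ?_
  · have h1 := hdet i
    rw [uexp_diagHom, det_block_diagHom, ← Complex.exp_sum, Complex.exp_eq_one_iff] at h1
    obtain ⟨m, hm⟩ := h1
    rw [← Finset.mul_sum, ← Complex.ofReal_sum] at hm
    have hm' := congr_arg Complex.im hm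
    simp only [Complex.mul_im, Complex.I_re, Complex.I_im, Complex.ofReal_re, Complex.ofReal_im,
      Complex.intCast_re, Complex.intCast_im, Complex.mul_re, Complex.re_ofNat,
      Complex.im_ofNat] at hm'
    have hs : ∑ k, θ i k = 2 * Real.pi * m := by linarith
    have hlt : |∑ k, θ i k| < 2 * Real.pi := by
      refine lt_of_le_of_lt ?_ (hd i)
      calc |∑ k, θ i k| ≤ ∑ k, |θ i k| := Finset.abs_sum_le_sum_abs _ _
        _ ≤ ∑ _k : Fin (d i), ‖diagHom Φ V fun i k => (θ i k : ℂ)‖ :=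
          Finset.sum_le_sum fun k _ => hθ i k
        _ = _ := by simp
    rw [hs, abs_mul, abs_of_pos Real.two_pi_pos] at hlt
    have : |(m : ℝ)| < 1 := by
      have := Real.two_pi_pos
      by_contra! hc
      nlinarith
    have hm0 : m = 0 := by
      rw [← Int.abs_lt_one_iff]
      exact_mod_cast this
    rw [hs, hm0]
    simp
  · have h1 := (abs_le.1 ((hθ i k).trans hπ)).2
    have h2 := (abs_le.1 ((hθ i l).trans hπ)).1
    linarith

end SmallLog

lemma exists_uexp_eq_of_norm_lt {A : Type*} [CStarAlgebra A] {u : A} (hu : u ∈ unitary A)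
    (h2 : ‖u - 1‖ < 2) :
    ∃ l, IsSelfAdjoint l ∧ uexp l = u ∧ ‖l‖ ≤ Real.pi / 2 * ‖u - 1‖ := by
  let l := Unitary.argSelfAdjoint (⟨u, hu⟩ : unitary A)
  refine ⟨l, l.2, ?_, ?_⟩
  · exact congrArg Subtype.val (_root_.expUnitary_argSelfAdjoint (u := ⟨u, hu⟩) h2)
  · have h := Unitary.two_mul_one_sub_cos_norm_argSelfAdjoint (u := ⟨u, hu⟩) h2
    have hl : ‖l‖ ≤ Real.pi := Unitary.norm_argSelfAdjoint_le_pi _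
    have hc := Real.cos_le_one_sub_mul_cos_sq (x := ‖l‖) (by rwa [abs_of_nonneg (norm_nonneg _)])
    change 2 * (1 - Real.cos ‖l‖) = ‖u - 1‖ ^ 2 at h
    change ‖l‖ ≤ _
    refine le_of_sq_le_sq ?_ (by positivity)
    have : 4 / Real.pi ^ 2 * ‖l‖ ^ 2 ≤ ‖u - 1‖ ^ 2 := by
      have : 4 / Real.pi ^ 2 * ‖l‖ ^ 2 = 2 * (2 / Real.pi ^ 2 * ‖l‖ ^ 2) := by ring
      linarith
    have hp : (0 : ℝ) < Real.pi ^ 2 / 4 := by positivity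
    calc ‖l‖ ^ 2 = Real.pi ^ 2 / 4 * (4 / Real.pi ^ 2 * ‖l‖ ^ 2) := by field_simp
      _ ≤ Real.pi ^ 2 / 4 * ‖u - 1‖ ^ 2 := by gcongr
      _ = _ := by ring

lemma commSpan_mono {F : Type*} [CStarAlgebra F] {a m y : F} (ha : IsSelfAdjoint a)
    (hy : y = a * m * a) : commSpan y ≤ commSpan a := by
  refine Submodule.span_mono ?_
  rintro _ ⟨n, rfl⟩
  refine ⟨m * a * n * a * star m, ?_⟩
  simp [hy, ha.star_eq, mul_assoc]

section Evaluation

variable (F₁ F₂ : Type*) [CStarAlgebra F₁] [CStarAlgebra F₂]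

/-- The canonical unital extension of the identity of a unital algebra to its unitization. -/
def unitizationRetract (E : Type*) [CStarAlgebra E] : Unitization ℂ E →⋆ₐ[ℂ] E :=
  Unitization.starLift (NonUnitalStarAlgHom.id ℂ E)

variable {F₁ F₂}

lemma unitizationRetract_apply {E : Type*} [CStarAlgebra E] (z : Unitization ℂ E) :
    unitizationRetract E z = algebraMap ℂ E z.fst + z.snd := rfl

lemma unitizationRetract_uexp {E : Type*} [CStarAlgebra E] (K : E) :
    unitizationRetract E (uexp (K : Unitization ℂ E)) = uexp K := by
  rw [map_uexp _ (map_continuous _), unitizationRetract_apply]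
  simp

lemma eq_of_unitizationRetract_eq {E : Type*} [CStarAlgebra E] {z w : Unitization ℂ E}
    (h1 : z.fst = w.fst) (h2 : unitizationRetract E z = unitizationRetract E w) : z = w := by
  refine Unitization.ext h1 ?_
  simpa [unitizationRetract_apply, h1] using h2

/-- Evaluation at `t`. -/
def evalAt (t : I) : C(I, F₂) × F₁ →⋆ₐ[ℂ] F₂ where
  toFun x := x.1 t
  map_one' := rfl
  map_mul' _ _ := rfl
  map_zero' := rfl
  map_add' _ _ := rfl
  commutes' _ := rfl
  map_star' _ := rfl

/-- Projection to the second summand. -/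
def evalSnd : C(I, F₂) × F₁ →⋆ₐ[ℂ] F₁ where
  toFun x := x.2
  map_one' := rfl
  map_mul' _ _ := rfl
  map_zero' := rfl
  map_add' _ _ := rfl
  commutes' _ := rfl
  map_star' _ := rfl

end Evaluation

section Fibre

variable {E : Type*} [CStarAlgebra E] {B : NonUnitalStarSubalgebra ℂ E} {e : E} {he : e ∈ B}
  {hes : IsSelfAdjoint e} {F : Type*} [CStarAlgebra F] (f : E →⋆ₐ[ℂ] F)

lemma map_retract_mem_unitary
    {z : Unitization ℂ E} (hz : z ∈ cuSubmonoid (herSub B e he hes)) :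
    f (unitizationRetract E z) ∈ unitary F :=
  Unitary.map_mem _ (Unitary.map_mem _
    (mem_unitizationUnitary_of_mem_cuSubmonoid isClosed_closure hz).1)

lemma commSpan_map_retract_le [FiniteDimensional ℂ F]
    {z : Unitization ℂ E} (hz : z ∈ cuSubmonoid (herSub B e he hes)) :
    commSpan (f (unitizationRetract E z) - 1) ≤ commSpan (f e) := by
  have hA := (mem_unitizationUnitary_of_mem_cuSubmonoid isClosed_closure hz).2
  obtain ⟨m, hm⟩ := map_mem_range_of_mem_herSub (f : E →⋆ₙₐ[ℂ] F) (map_continuous f) hA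
  refine commSpan_mono (m := m) (hes.map f) ?_
  rw [unitizationRetract_apply, fst_eq_one_of_mem_cuSubmonoid hz]
  simpa using hm

lemma det_block_map_retract [FiniteDimensional ℂ F] {n : ℕ} {d : Fin n → ℕ}
    (Φ : F ≃⋆ₐ[ℂ] ((i : Fin n) → Matrix (Fin (d i)) (Fin (d i)) ℂ)) (i : Fin n)
    {z : Unitization ℂ E} (hz : z ∈ cuSubmonoid (herSub B e he hes)) :
    (Φ (f (unitizationRetract E z)) i).det = 1 := by
  let χ : Unitization ℂ E →* ℂ :=
    { toFun := fun z => (Φ (f (unitizationRetract E z)) i).det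
      map_one' := by simp
      map_mul' := fun x y => by simp }
  refine map_eq_one_of_mem_cuSubmonoid χ ?_ hz
  exact ((continuous_block Φ i).comp
    ((map_continuous f).comp (map_continuous (unitizationRetract E)))).matrix_det

lemma IsLog.mem_commSpan {F : Type*} [CStarAlgebra F] {n : ℕ} {d : Fin n → ℕ}
    {Φ : F ≃⋆ₐ[ℂ] ((i : Fin n) → Matrix (Fin (d i)) (Fin (d i)) ℂ)} {u h : F}
    (hh : IsLog Φ u h) : h ∈ commSpan (u - 1) := by
  obtain ⟨c, m, rfl⟩ := hh.exists_eq_sum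
  exact Submodule.sum_mem _ fun r _ => Submodule.smul_mem _ _ (Submodule.subset_span ⟨m r, rfl⟩)

end Fibre

end CUPath

namespace CUPath

open Topology Filter unitInterval
open scoped CStarAlgebra

section Factor

variable {F₁ F₂ : Type*} [CStarAlgebra F₁] [CStarAlgebra F₂] {φ₀ φ₁ : F₁ →⋆ₙₐ[ℂ] F₂}
  {e : C(I, F₂) × F₁} {he : e ∈ etSub φ₀ φ₁} {hes : IsSelfAdjoint e}

lemma inr_mem_expSubspace {K : C(I, F₂) × F₁} (hK : K ∈ closure (corSpan φ₀ φ₁ e : Set _)) :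
    (K : Unitization ℂ (C(I, F₂) × F₁)) ∈ expSubspace (cuSubmonoid (herSub (etSub φ₀ φ₁) e he hes))
      (isClosed_cuSubmonoid _) := by
  have hle : corSpan φ₀ φ₁ e ≤ (expSubspace (cuSubmonoid (herSub (etSub φ₀ φ₁) e he hes))
      (isClosed_cuSubmonoid _)).comap
      ((Unitization.inrHom ℂ ℂ (C(I, F₂) × F₁)).restrictScalars ℝ) := by
    refine Submodule.span_le.2 ?_
    rintro _ ⟨b, hb, rfl⟩
    exact inr_selfComm_mem_expSubspace isClosed_closure (mul_mul_mem_herSub hb)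
  exact closure_minimal (t := (fun K : C(I, F₂) × F₁ => (K : Unitization ℂ (C(I, F₂) × F₁))) ⁻¹'
    (expSubspace (cuSubmonoid (herSub (etSub φ₀ φ₁) e he hes)) (isClosed_cuSubmonoid _) : Set _))
    hle ((isClosed_expSubspace _ _).preimage (Unitization.isometry_inr (𝕜 := ℂ)).continuous) hK

lemma norm_le_of_forall {x : C(I, F₂) × F₁} {r : ℝ} (hr : 0 ≤ r) (h1 : ∀ t, ‖x.1 t‖ ≤ r)
    (h2 : ‖x.2‖ ≤ r) : ‖x‖ ≤ r :=
  max_le ((ContinuousMap.norm_le _ hr).2 h1) h2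

lemma evalSnd_apply (x : C(I, F₂) × F₁) : evalSnd x = x.2 := rfl

lemma exists_isLog_map_retract {F : Type*} [CStarAlgebra F] [FiniteDimensional ℂ F] {n : ℕ}
    {d : Fin n → ℕ} (Φ : F ≃⋆ₐ[ℂ] ((i : Fin n) → Matrix (Fin (d i)) (Fin (d i)) ℂ))
    {E : Type*} [CStarAlgebra E] {B : NonUnitalStarSubalgebra ℂ E} {e : E} {he : e ∈ B}
    {hes : IsSelfAdjoint e} (f : E →⋆ₐ[ℂ] F) {z : Unitization ℂ E}
    (hz : z ∈ cuSubmonoid (herSub B e he hes)) :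
    ∃ h, IsLog Φ (f (unitizationRetract E z)) h := by
  exact exists_isLog Φ (map_retract_mem_unitary f hz) fun i => det_block_map_retract f Φ i hz

/-- A small logarithm of an element of `CU(Ã)` is traceless in every finite-dimensional fibre. -/
lemma isLog_map_of_uexp_eq {F : Type*} [CStarAlgebra F] [FiniteDimensional ℂ F] {n : ℕ}
    {d : Fin n → ℕ} (Φ : F ≃⋆ₐ[ℂ] ((i : Fin n) → Matrix (Fin (d i)) (Fin (d i)) ℂ))
    {E : Type*} [CStarAlgebra E] {B : NonUnitalStarSubalgebra ℂ E} {e : E} {he : e ∈ B}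
    {hes : IsSelfAdjoint e} (f : E →⋆ₐ[ℂ] F) {z : Unitization ℂ E}
    (hz : z ∈ cuSubmonoid (herSub B e he hes)) {l : E} (hl : IsSelfAdjoint l)
    (hlz : uexp l = unitizationRetract E z) (hπ : ‖l‖ ≤ Real.pi)
    (hd : ∀ i, d i * ‖l‖ < 2 * Real.pi) : IsLog Φ (f (unitizationRetract E z)) (f l) := by
  have hfl : ‖f l‖ ≤ ‖l‖ := NonUnitalStarAlgHom.norm_apply_le f l
  have hfv : f (unitizationRetract E z) = uexp (f l) := by
    rw [← hlz, map_uexp f (map_continuous f)]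
  rw [hfv]
  refine isLog_of_norm_lt Φ (hl.map f) (hfl.trans hπ) (fun i => ?_) fun i => ?_
  · exact (mul_le_mul_of_nonneg_left hfl (Nat.cast_nonneg _)).trans_lt (hd i)
  · rw [← hfv]
    exact det_block_map_retract f Φ i hz

lemma exists_mem_corSpan_snd [FiniteDimensional ℂ F₁] {z : Unitization ℂ (C(I, F₂) × F₁)}
    (hz : z ∈ cuSubmonoid (herSub (etSub φ₀ φ₁) e he hes)) :
    ∃ K ∈ corSpan φ₀ φ₁ e, ‖K‖ ≤ 2 * Real.pi ∧
      uexp K.2 = (unitizationRetract (C(I, F₂) × F₁) z).2 := by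
  obtain ⟨n, d, ⟨Φ⟩⟩ := exists_starAlgEquiv_pi_matrix F₁
  obtain ⟨h, hh⟩ := exists_isLog_map_retract Φ (evalSnd (F₁ := F₁) (F₂ := F₂)) hz
  have hmem := commSpan_map_retract_le (evalSnd (F₁ := F₁) (F₂ := F₂)) hz hh.mem_commSpan
  rw [evalSnd_apply] at hh hmem
  obtain ⟨K, hK, rfl⟩ := exists_mem_corSpan_snd_eq (φ₀ := φ₀) (φ₁ := φ₁) hes hmem
  have hb := mem_etSub.1 (mem_etSub_of_mem_corSpan he hK)
  have hnorm : ‖K.2‖ ≤ 2 * Real.pi := hh.norm_le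
  have hpos := Real.two_pi_pos
  have hne : ∀ t, max (2 * Real.pi) ‖K.1 t‖ ≠ 0 := fun t => (lt_max_of_lt_left hpos).ne'
  let ρ : C(I, ℝ) := ⟨fun t => 2 * Real.pi / max (2 * Real.pi) ‖K.1 t‖,
    continuous_const.div (by fun_prop) hne⟩
  have hρ : ∀ t, ‖K.1 t‖ ≤ 2 * Real.pi → ρ t = 1 := fun t ht => by
    simp [ρ, max_eq_left ht]
  have h0 : ρ 0 = 1 := hρ 0 (hb.1 ▸ (NonUnitalStarAlgHom.norm_apply_le φ₀ _).trans hnorm)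
  have h1 : ρ 1 = 1 := hρ 1 (hb.2 ▸ (NonUnitalStarAlgHom.norm_apply_le φ₁ _).trans hnorm)
  have hρ0 : ∀ t, 0 ≤ ρ t := fun t => div_nonneg hpos.le (hpos.le.trans (le_max_left _ _))
  refine ⟨_, smul_mem_corSpan hK hρ0 h0 h1, norm_le_of_forall hpos.le (fun t => ?_) ?_, ?_⟩
  · change ‖ρ t • K.1 t‖ ≤ _
    rw [norm_smul, Real.norm_of_nonneg (hρ0 t)]
    change 2 * Real.pi / max (2 * Real.pi) ‖K.1 t‖ * ‖K.1 t‖ ≤ _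
    rw [div_mul_eq_mul_div, div_le_iff₀ (lt_max_of_lt_left hpos)]
    gcongr
    exact le_max_right _ _
  · simpa using hnorm
  · simpa using hh.uexp_eq

lemma retract_endpoints {z : Unitization ℂ (C(I, F₂) × F₁)}
    (hz : z ∈ cuSubmonoid (herSub (etSub φ₀ φ₁) e he hes))
    (h2 : (unitizationRetract (C(I, F₂) × F₁) z).2 = 1) :
    (unitizationRetract (C(I, F₂) × F₁) z).1 0 = 1 ∧
      (unitizationRetract (C(I, F₂) × F₁) z).1 1 = 1 := by
  have hA := (mem_unitizationUnitary_of_mem_cuSubmonoid isClosed_closure hz).2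
  have hle : z.snd ∈ etSub φ₀ φ₁ := by
    have hcl : IsClosed (etSub φ₀ φ₁ : Set (C(I, F₂) × F₁)) := by
      refine IsClosed.inter (isClosed_eq ?_ ?_) (isClosed_eq ?_ ?_)
      · exact map_continuous (evalAt (F₁ := F₁) (F₂ := F₂) 0)
      · exact (map_continuous φ₀).comp continuous_snd
      · exact map_continuous (evalAt (F₁ := F₁) (F₂ := F₂) 1)
      · exact (map_continuous φ₁).comp continuous_snd
    refine closure_minimal ?_ hcl hA
    rintro _ ⟨b, hb, rfl⟩
    exact mul_mem (mul_mem he hb) he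
  have hv : unitizationRetract (C(I, F₂) × F₁) z = 1 + z.snd := by
    rw [unitizationRetract_apply, fst_eq_one_of_mem_cuSubmonoid hz, map_one]
  rw [hv] at h2 ⊢
  have h2' : z.snd.2 = 0 := by simpa using h2
  obtain ⟨h, h'⟩ := mem_etSub.1 hle
  rw [h2', map_zero φ₀] at h
  rw [h2', map_zero φ₁] at h'
  refine ⟨?_, ?_⟩
  · change (1 : F₂) + z.snd.1 0 = 1
    rw [h, add_zero]
  · change (1 : F₂) + z.snd.1 1 = 1
    rw [h', add_zero]

lemma exists_mem_corSpan_approx [FiniteDimensional ℂ F₂] {z : Unitization ℂ (C(I, F₂) × F₁)}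
    (hz : z ∈ cuSubmonoid (herSub (etSub φ₀ φ₁) e he hes))
    (h2 : (unitizationRetract (C(I, F₂) × F₁) z).2 = 1) {η δ : ℝ} (hη : 0 < η) (hδ : 0 < δ) :
    ∃ K ∈ corSpan φ₀ φ₁ e, K.2 = 0 ∧ ‖K‖ ≤ 2 * Real.pi + η ∧
      ‖uexp K - unitizationRetract (C(I, F₂) × F₁) z‖ ≤ δ := by
  have hpos := Real.two_pi_pos
  obtain ⟨n, d, ⟨Φ⟩⟩ := exists_starAlgEquiv_pi_matrix F₂
  set v := unitizationRetract (C(I, F₂) × F₁) z with hv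
  have hprop : ProperSpace F₂ := FiniteDimensional.proper ℂ F₂
  have huc := (isCompact_closedBall (0 : F₂) (2 * Real.pi + η)).uniformContinuousOn_of_continuous
    (continuous_uexp (𝔸 := F₂)).continuousOn
  obtain ⟨r, hr, hr'⟩ := Metric.uniformContinuousOn_iff.1 huc (δ / 2) (half_pos hδ)
  set μ := min (η / 2) (r / 2) with hμ
  have hμ0 : 0 < μ := lt_min (half_pos hη) (half_pos hr)
  have hμη : μ ≤ η / 2 := min_le_left _ _
  have hμr : μ ≤ r / 2 := min_le_right _ _
  have hends := retract_endpoints hz h2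
  let U : ℝ → F₂ := fun t => v.1 (Set.projIcc 0 1 zero_le_one t)
  have hU : Continuous U := v.1.continuous.comp continuous_projIcc
  obtain ⟨h, hc, h0, h1, happ⟩ := exists_isApproxLog_path Φ hU (fun t =>
    exists_isLog_map_retract Φ (evalAt (F₁ := F₁) (F₂ := F₂) (Set.projIcc 0 1 zero_le_one t)) hz)
    (by simpa [U] using hends.1) (by simpa [U] using hends.2) hμ0 (half_pos hδ)
  have hUt : ∀ t : I, U t = v.1 t := fun t => by simp [U]
  obtain ⟨K, hK, hK2, hKh⟩ := exists_mem_corSpan_near (φ₀ := φ₀) (φ₁ := φ₁) hes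
    (h := ⟨fun t : I => h t, hc.comp continuous_subtype_val⟩) (by simpa using h0)
    (by simpa using h1) hμ0 fun t => by
      obtain ⟨k, hk, hkn⟩ := (happ t t.2).exists_near_commSpan
      rw [hUt] at hk
      exact ⟨k, commSpan_map_retract_le (evalAt (F₁ := F₁) (F₂ := F₂) t) hz hk, hkn⟩
  have hkey : ∀ t : I, ‖K.1 t‖ ≤ 2 * Real.pi + η ∧ ‖uexp (K.1 t) - v.1 t‖ ≤ δ := by
    intro t
    obtain ⟨k, hk, hkn, hku⟩ := (happ t t.2).exists_near_log
    have hKt : ‖K.1 t - h t‖ < μ := hKh t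
    have hdist : ‖K.1 t - k‖ < 2 * μ := by
      have := norm_sub_le_norm_sub_add_norm_sub (K.1 t) (h t) k
      linarith
    have hn : ‖K.1 t‖ ≤ 2 * Real.pi + η := by
      have := norm_le_norm_add_norm_sub' (K.1 t) k
      linarith
    refine ⟨hn, ?_⟩
    have hd := hr' (K.1 t) (by simpa using hn) k (by simp; linarith)
      (by rw [dist_eq_norm]; linarith)
    rw [dist_eq_norm] at hd
    rw [hUt] at hku
    have := norm_sub_le_norm_sub_add_norm_sub (uexp (K.1 t)) (uexp k) (v.1 t)
    linarith
  refine ⟨K, hK, hK2, norm_le_of_forall (by positivity) (fun t => (hkey t).1) ?_,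
    norm_le_of_forall hδ.le (fun t => ?_) ?_⟩
  · rw [hK2, norm_zero]
    positivity
  · have : (uexp K - v).1 t = uexp (K.1 t) - v.1 t := by
      have := map_uexp (evalAt (F₁ := F₁) t) (map_continuous _) K
      change (uexp K).1 t - v.1 t = _
      exact congrArg (· - v.1 t) this
    rw [this]
    exact (hkey t).2
  · have : (uexp K - v).2 = uexp K.2 - v.2 := by
      have := map_uexp (evalSnd (F₁ := F₁) (F₂ := F₂)) (map_continuous _) K
      change (uexp K).2 - v.2 = _
      exact congrArg (· - v.2) this
    rw [this, hK2, uexp_zero, h2, sub_self, norm_zero]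
    exact hδ.le

lemma exists_uexp_eq_of_near_one [FiniteDimensional ℂ F₁] [FiniteDimensional ℂ F₂] {η : ℝ}
    (hη : 0 < η) :
    ∃ δ > 0, ∀ z ∈ cuSubmonoid (herSub (etSub φ₀ φ₁) e he hes),
      (unitizationRetract (C(I, F₂) × F₁) z).2 = 1 →
      ‖unitizationRetract (C(I, F₂) × F₁) z - 1‖ ≤ δ →
      ∃ l ∈ closure (corSpan φ₀ φ₁ e : Set (C(I, F₂) × F₁)), ‖l‖ ≤ η ∧
        z = uexp (l : Unitization ℂ (C(I, F₂) × F₁)) := by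
  obtain ⟨n₁, d₁, ⟨Φ₁⟩⟩ := exists_starAlgEquiv_pi_matrix F₁
  obtain ⟨n₂, d₂, ⟨Φ₂⟩⟩ := exists_starAlgEquiv_pi_matrix F₂
  have hpi := Real.pi_pos
  set D : ℝ := ∑ i, (d₁ i : ℝ) + ∑ i, (d₂ i : ℝ) + 1 with hD
  have hs1 : 0 ≤ ∑ i, (d₁ i : ℝ) := Finset.sum_nonneg fun _ _ => Nat.cast_nonneg _
  have hs2 : 0 ≤ ∑ i, (d₂ i : ℝ) := Finset.sum_nonneg fun _ _ => Nat.cast_nonneg _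
  have hD1 : ∀ i, (d₁ i : ℝ) ≤ D := fun i => by
    have := Finset.single_le_sum (f := fun i => (d₁ i : ℝ)) (fun _ _ => Nat.cast_nonneg _)
      (Finset.mem_univ i)
    linarith
  have hD2 : ∀ i, (d₂ i : ℝ) ≤ D := fun i => by
    have := Finset.single_le_sum (f := fun i => (d₂ i : ℝ)) (fun _ _ => Nat.cast_nonneg _)
      (Finset.mem_univ i)
    linarith
  have hD0 : 1 ≤ D := by linarith
  set μ := min η (Real.pi / D) with hμ
  have hμ0 : 0 < μ := lt_min hη (by positivity)
  have hμD : D * μ ≤ Real.pi := by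
    calc D * μ ≤ D * (Real.pi / D) := by gcongr; exact min_le_right _ _
      _ = Real.pi := by field_simp
  refine ⟨min 1 (μ * (2 / Real.pi)), by positivity, fun z hz h2 hzδ => ?_⟩
  set v := unitizationRetract (C(I, F₂) × F₁) z with hv
  obtain ⟨l, hl, hlv, hln⟩ := exists_uexp_eq_of_norm_lt
    (map_retract_mem_unitary (StarAlgHom.id ℂ _) hz)
    (show ‖v - 1‖ < 2 from (hzδ.trans (min_le_left _ _)).trans_lt (by norm_num))
  change uexp l = v at hlv
  change ‖l‖ ≤ Real.pi / 2 * ‖v - 1‖ at hln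
  have hlμ : ‖l‖ ≤ μ := by
    calc ‖l‖ ≤ Real.pi / 2 * ‖v - 1‖ := hln
      _ ≤ Real.pi / 2 * (μ * (2 / Real.pi)) := by gcongr; exact hzδ.trans (min_le_right _ _)
      _ = μ := by field_simp
  have hlπ : ‖l‖ ≤ Real.pi := by nlinarith [norm_nonneg l]
  have hlD : ∀ k : ℕ, (k : ℝ) ≤ D → k * ‖l‖ < 2 * Real.pi := fun k hk => by
    have := mul_le_mul hk hlμ (norm_nonneg _) (by linarith)
    linarith
  have hl1 : IsLog Φ₁ v.2 l.2 := isLog_map_of_uexp_eq Φ₁ (evalSnd (F₁ := F₁) (F₂ := F₂)) hz hl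
    hlv hlπ fun i => hlD _ (hD1 i)
  have hl2 : ∀ t, IsLog Φ₂ (v.1 t) (l.1 t) := fun t =>
    isLog_map_of_uexp_eq Φ₂ (evalAt (F₁ := F₁) (F₂ := F₂) t) hz hl hlv hlπ fun i => hlD _ (hD2 i)
  have hmem : ∀ t, l.1 t ∈ commSpan (e.1 t) := fun t =>
    commSpan_map_retract_le (evalAt (F₁ := F₁) (F₂ := F₂) t) hz (hl2 t).mem_commSpan
  have hl20 : l.2 = 0 := (h2 ▸ hl1).eq_zero
  obtain ⟨hv0, hv1⟩ := retract_endpoints hz h2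
  have hl0 : l.1 0 = 0 := (hv0 ▸ hl2 0).eq_zero
  have hl1' : l.1 1 = 0 := (hv1 ▸ hl2 1).eq_zero
  have hcl : l ∈ closure (corSpan φ₀ φ₁ e : Set (C(I, F₂) × F₁)) := by
    refine Metric.mem_closure_iff.2 fun r hr => ?_
    obtain ⟨K, hK, hK2, hKl⟩ := exists_mem_corSpan_near (φ₀ := φ₀) (φ₁ := φ₁) hes hl0 hl1'
      (half_pos hr) fun t => ⟨l.1 t, hmem t, by simpa using half_pos hr⟩
    refine ⟨K, hK, ?_⟩
    rw [dist_comm, dist_eq_norm]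
    refine (norm_le_of_forall (half_pos hr).le (fun t => (hKl t).le) ?_).trans_lt (half_lt_self hr)
    change ‖K.2 - l.2‖ ≤ _
    rw [hK2, hl20, sub_self, norm_zero]
    exact (half_pos hr).le
  refine ⟨l, hcl, hlμ.trans (min_le_left _ _), eq_of_unitizationRetract_eq ?_ ?_⟩
  · have := (inr_mem_expSubspace (he := he) (hes := hes) hcl).2 1
    rw [one_smul] at this
    rw [fst_eq_one_of_mem_cuSubmonoid hz, fst_eq_one_of_mem_cuSubmonoid this]
  · rw [unitizationRetract_uexp, hlv]

end Factor

end CUPath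

namespace CUPath

open Topology Filter unitInterval
open scoped CStarAlgebra

lemma norm_mul_sub_mul_le {A : Type*} [CStarAlgebra A] {a b a' b' : A} (hb : b ∈ unitary A)
    (ha' : a' ∈ unitary A) : ‖a * b - a' * b'‖ ≤ ‖a - a'‖ + ‖b - b'‖ := by
  have h1 : ‖b‖ ≤ 1 := norm_le_one_of_mem_unitary hb
  have h2 : ‖a'‖ ≤ 1 := norm_le_one_of_mem_unitary ha'
  calc ‖a * b - a' * b'‖ = ‖(a - a') * b + a' * (b - b')‖ := by noncomm_ring
    _ ≤ ‖a - a'‖ * ‖b‖ + ‖a'‖ * ‖b - b'‖ :=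
      (norm_add_le _ _).trans (add_le_add (norm_mul_le _ _) (norm_mul_le _ _))
    _ ≤ ‖a - a'‖ * 1 + 1 * ‖b - b'‖ := by gcongr
    _ = _ := by ring

lemma uexp_zero_smul {A : Type*} [CStarAlgebra A] (a : A) : uexp ((0 : ℝ) • a) = 1 := by
  rw [zero_smul, uexp_zero]

/-- Contracting the exponents of a product of three exponentials gives a path to `1`. -/
lemma norm_uexp_prod_sub_le {A : Type*} [CStarAlgebra A] {x y z : A} (hx : IsSelfAdjoint x)
    (hy : IsSelfAdjoint y) (hz : IsSelfAdjoint z) (s t : ℝ) :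
    ‖uexp (s • x) * uexp (s • y) * uexp (s • z) - uexp (t • x) * uexp (t • y) * uexp (t • z)‖ ≤
      (‖x‖ + ‖y‖ + ‖z‖) * |s - t| := by
  have hu : ∀ {a : A}, IsSelfAdjoint a → ∀ r : ℝ, uexp (r • a) ∈ unitary A := fun ha r =>
    uexp_mem_unitary (isSelfAdjoint_real_smul ha r)
  calc _ ≤ ‖uexp (s • x) - uexp (t • x)‖ + ‖uexp (s • y) - uexp (t • y)‖ +
        ‖uexp (s • z) - uexp (t • z)‖ := by
        refine (norm_mul_sub_mul_le (hu hz s) (mul_mem (hu hx t) (hu hy t))).trans ?_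
        gcongr
        exact norm_mul_sub_mul_le (hu hy s) (hu hx t)
    _ ≤ ‖x‖ * |s - t| + ‖y‖ * |s - t| + ‖z‖ * |s - t| := by
        gcongr <;> apply norm_uexp_smul_sub_le <;> assumption
    _ = _ := by ring

lemma eVariationOn_le_of_norm_sub_le {A : Type*} [SeminormedAddCommGroup A] {w : ℝ → A} {L : ℝ}
    (hL : ∀ s t, ‖w s - w t‖ ≤ L * |s - t|) :
    eVariationOn w (Set.Icc 0 1) ≤ ENNReal.ofReal L := by
  have hlip : LipschitzWith L.toNNReal w := LipschitzWith.of_dist_le' fun s t => by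
    rw [dist_eq_norm, Real.dist_eq]
    exact hL s t
  have h := (hlip.lipschitzOnWith (s := Set.univ)).comp_eVariationOn_le
    (Set.mapsTo_univ id (Set.Icc (0 : ℝ) 1))
  rw [eVariationOn_id_Icc] at h
  simpa [ENNReal.ofReal] using h

section Factor

variable {F₁ F₂ : Type*} [CStarAlgebra F₁] [CStarAlgebra F₂] {φ₀ φ₁ : F₁ →⋆ₙₐ[ℂ] F₂}
  {e : C(I, F₂) × F₁} {he : e ∈ etSub φ₀ φ₁} {hes : IsSelfAdjoint e}

lemma exists_eq_uexp_prod [FiniteDimensional ℂ F₁] [FiniteDimensional ℂ F₂]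
    {u : Unitization ℂ (C(I, F₂) × F₁)}
    (hu : u ∈ cuSubmonoid (herSub (etSub φ₀ φ₁) e he hes)) {ε : ℝ} (hε : 0 < ε) :
    ∃ l ∈ closure (corSpan φ₀ φ₁ e : Set (C(I, F₂) × F₁)),
      ∃ K ∈ corSpan φ₀ φ₁ e, ∃ H ∈ corSpan φ₀ φ₁ e,
        ‖l‖ + ‖K‖ + ‖H‖ ≤ 4 * Real.pi + ε ∧
          u = uexp (l : Unitization ℂ (C(I, F₂) × F₁)) * uexp (K : Unitization ℂ (C(I, F₂) × F₁)) *
            uexp (H : Unitization ℂ (C(I, F₂) × F₁)) := by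
  have hmem : ∀ {x}, x ∈ corSpan φ₀ φ₁ e → uexp (-(x : Unitization ℂ (C(I, F₂) × F₁))) ∈
      cuSubmonoid (herSub (etSub φ₀ φ₁) e he hes) := fun {x} hx => by
    have := (inr_mem_expSubspace (he := he) (hes := hes)
      (subset_closure (neg_mem hx : -x ∈ corSpan φ₀ φ₁ e))).2 1
    rwa [one_smul, Unitization.inr_neg] at this
  have hretr : ∀ (z : Unitization ℂ (C(I, F₂) × F₁)) (x : C(I, F₂) × F₁),
      unitizationRetract (C(I, F₂) × F₁) (z * uexp (-(x : Unitization ℂ (C(I, F₂) × F₁)))) =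
        unitizationRetract (C(I, F₂) × F₁) z * uexp (-x) := fun z x => by
    rw [map_mul, ← Unitization.inr_neg, unitizationRetract_uexp]
  have hsnd : ∀ (v x : C(I, F₂) × F₁), (v * uexp (-x)).2 = v.2 * uexp (-x.2) := fun v x => by
    rw [← evalSnd_apply, map_mul, map_uexp evalSnd (map_continuous _), map_neg]
    rfl
  obtain ⟨δ, hδ, hsmall⟩ := exists_uexp_eq_of_near_one (φ₀ := φ₀) (φ₁ := φ₁) (he := he)
    (hes := hes) (half_pos hε)
  obtain ⟨H, hH, hHn, hHu⟩ := exists_mem_corSpan_snd hu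
  have hz₁ := mul_mem hu (hmem hH)
  have h₁ : (unitizationRetract (C(I, F₂) × F₁)
      (u * uexp (-(H : Unitization ℂ (C(I, F₂) × F₁))))).2 = 1 := by
    rw [hretr, hsnd, ← hHu, uexp_mul_uexp_neg]
  obtain ⟨K, hK, hK2, hKn, hKu⟩ := exists_mem_corSpan_approx hz₁ h₁ (half_pos hε) hδ
  obtain ⟨l, hl, hln, hlu⟩ := hsmall _ (mul_mem hz₁ (hmem hK))
    (by rw [hretr, hsnd, h₁, hK2, neg_zero, uexp_zero, one_mul]) (by
      rw [hretr, ← uexp_mul_uexp_neg K, ← sub_mul, ← norm_neg, ← neg_mul, neg_sub]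
      have hun : uexp (-K) ∈ unitary (C(I, F₂) × F₁) :=
        uexp_mem_unitary (isSelfAdjoint_of_mem_corSpan hK).neg
      calc _ ≤ ‖uexp K - _‖ * ‖uexp (-K)‖ := norm_mul_le _ _
        _ ≤ δ * 1 := by gcongr; exact norm_le_one_of_mem_unitary hun
        _ = δ := mul_one δ)
  refine ⟨l, hl, K, hK, H, hH, by linarith, ?_⟩
  rw [← hlu, mul_assoc (u * _), uexp_neg_mul_uexp, mul_one, mul_assoc u, uexp_neg_mul_uexp,
    mul_one]

end Factor

end CUPath

/-- Let `B = A(F₁, F₂, φ₀, φ₁)` be an Elliott–Thomsen building block, `e ∈ B` positive with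
`‖e‖ = 1` such that `A = closure (eBe)` is full in `B`.  Then every unitary `u ∈ CU(Ã)` can be
joined to `1` by a continuous path of unitaries lying in `CU(Ã)` whose length is at most
`4π + ε`. -/
theorem statement1
    {F₁ F₂ : Type} [CStarAlgebra F₁] [CStarAlgebra F₂]
    [FiniteDimensional ℂ F₁] [FiniteDimensional ℂ F₂] (φ₀ φ₁ : F₁ →⋆ₙₐ[ℂ] F₂)
    (e : C(I, F₂) × F₁) (heB : e ∈ ETBlock φ₀ φ₁)
    (hepos : ∃ s : C(I, F₂) × F₁, e = star s * s) (henorm : ‖e‖ = 1)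
    (hfull : IsFullIn (herSet (ETBlock φ₀ φ₁) e) (ETBlock φ₀ φ₁))
    (u : Unitization ℂ (C(I, F₂) × F₁))
    (hu : u ∈ unitizationCU (herSet (ETBlock φ₀ φ₁) e))
    (ε : ℝ) (hε : 0 < ε) :
    ∃ w : ℝ → Unitization ℂ (C(I, F₂) × F₁),
      ContinuousOn w (Set.Icc 0 1) ∧ w 0 = u ∧ w 1 = 1 ∧
      (∀ t ∈ Set.Icc (0 : ℝ) 1,
        w t ∈ unitizationUnitary (herSet (ETBlock φ₀ φ₁) e) ∧
        w t ∈ unitizationCU (herSet (ETBlock φ₀ φ₁) e)) ∧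
      eVariationOn w (Set.Icc 0 1) ≤ ENNReal.ofReal (4 * Real.pi + ε) := by
  have hes : IsSelfAdjoint e := by
    obtain ⟨s, rfl⟩ := hepos
    exact IsSelfAdjoint.star_mul_self s
  have he : e ∈ CUPath.etSub φ₀ φ₁ := heB
  obtain ⟨l, hl, K, hK, H, hH, hn, rfl⟩ := CUPath.exists_eq_uexp_prod (he := he) (hes := hes) hu hε
  have hL := CUPath.inr_mem_expSubspace (he := he) (hes := hes) hl
  have hK := CUPath.inr_mem_expSubspace (he := he) (hes := hes) (subset_closure hK)
  have hH := CUPath.inr_mem_expSubspace (he := he) (hes := hes) (subset_closure hH)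
  set x : Unitization ℂ (C(I, F₂) × F₁) := Unitization.inr l with hx
  set y : Unitization ℂ (C(I, F₂) × F₁) := Unitization.inr K with hy
  set z : Unitization ℂ (C(I, F₂) × F₁) := Unitization.inr H with hz
  have hcu : ∀ t : ℝ, CUPath.uexp ((1 - t) • x) * CUPath.uexp ((1 - t) • y) *
      CUPath.uexp ((1 - t) • z) ∈ CUPath.cuSubmonoid (CUPath.herSub (CUPath.etSub φ₀ φ₁) e he hes) :=
    fun t => mul_mem (mul_mem (hL.2 _) (hK.2 _)) (hH.2 _)
  have hnorm : ‖x‖ + ‖y‖ + ‖z‖ ≤ 4 * Real.pi + ε := by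
    simpa only [hx, hy, hz, Unitization.norm_inr] using hn
  have hlip : ∀ s t : ℝ, ‖CUPath.uexp ((1 - s) • x) * CUPath.uexp ((1 - s) • y) *
      CUPath.uexp ((1 - s) • z) - CUPath.uexp ((1 - t) • x) * CUPath.uexp ((1 - t) • y) *
      CUPath.uexp ((1 - t) • z)‖ ≤ (4 * Real.pi + ε) * |s - t| := fun s t => by
    refine (CUPath.norm_uexp_prod_sub_le hL.1 hK.1 hH.1 _ _).trans ?_
    rw [sub_sub_sub_cancel_left, abs_sub_comm]
    gcongr
  refine ⟨fun t => CUPath.uexp ((1 - t) • x) * CUPath.uexp ((1 - t) • y) *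
    CUPath.uexp ((1 - t) • z), Continuous.continuousOn ?_, by simp,
    by simp only [sub_self, CUPath.uexp_zero_smul, mul_one],
    fun t _ => ⟨?_, hcu t⟩, CUPath.eVariationOn_le_of_norm_sub_le hlip⟩
  · have := CUPath.continuous_uexp (𝔸 := Unitization ℂ (C(I, F₂) × F₁))
    fun_prop
  · exact CUPath.mem_unitizationUnitary_of_mem_cuSubmonoid isClosed_closure (hcu t)
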